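/- Let S be a 3-rigid Coxeter generating set of type FC and {s,t} ⊆ S irreducible spherical. For any component A of S∖({s,t} ∪ {s,t}^⊥) and any two simple markings μ, μ′ with supports containing t, core s, and K^μ_{s,t}, K^{μ′}_{s,t} ⊆ A, the associated halfspaces satisfy Φ^μ_s = Φ^{μ′}_s. In other words, the halfspace Φ^{t,A}_s depends only on s, t and the component A. -/

import Mathlib

open scoped Classical

variable {B B' W : Type} [Group W]

/-- A subset `J` of the index set is spherical if the standard parabolic subgroup it
generates is finite. -/
def SphericalIdx {M : CoxeterMatrix B} (cs : CoxeterSystem M W) (J : Set B) : Prop :=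
  Set.Finite ((Subgroup.closure (cs.simple '' J) : Subgroup W) : Set W)

/-- A Coxeter system is of type FC if every subset of pairwise adjacent indices is
spherical. -/
def IsFC {M : CoxeterMatrix B} (cs : CoxeterSystem M W) : Prop :=
  ∀ J : Set B, (∀ a ∈ J, ∀ b ∈ J, a ≠ b → M a b ≠ 0) → SphericalIdx cs J

/-- `K^⊥` at the level of the index set. -/
def perpIdx (M : CoxeterMatrix B) (K : Set B) : Set B :=
  {a | a ∉ K ∧ ∀ k ∈ K, M a k = 2}

/-- `J` is irreducible. -/
def IrredIdx (M : CoxeterMatrix B) (J : Set B) : Prop :=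
  ∀ K : Set B, K ⊂ J → K.Nonempty → ¬ J ⊆ K ∪ perpIdx M K

/-- `a, b` lie in the same component of the defining graph induced on the complement
of `X`. -/
def SameCompIdx (M : CoxeterMatrix B) (X : Set B) (a b : B) : Prop :=
  a ∉ X ∧ b ∉ X ∧
    Relation.ReflTransGen (fun x y => x ∉ X ∧ y ∉ X ∧ x ≠ y ∧ M x y ≠ 0) a b

/-- `S` is 3-rigid: no irreducible spherical (pairwise adjacent) subset of size `≥ 3`
weakly separates the defining graph. -/
def ThreeRigidIdx (M : CoxeterMatrix B) : Prop :=
  ∀ J : Set B, (∀ a ∈ J, ∀ b ∈ J, a ≠ b → M a b ≠ 0) → IrredIdx M J → 3 ≤ J.ncard →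
    ∀ a b : B, a ∉ J ∪ perpIdx M J → b ∉ J ∪ perpIdx M J →
      SameCompIdx M (J ∪ perpIdx M J) a b

/-- `A` is a connected component of the defining graph induced on the complement
of `X`. -/
def IsCompIdx (M : CoxeterMatrix B) (X A : Set B) : Prop :=
  ∃ a₀, a₀ ∉ X ∧ A = {b | SameCompIdx M X a₀ b}

/-- The chamber `y` of the ambient Davis complex is incident to the wall of the
reflection `x`. -/
def IncidentWall {M' : CoxeterMatrix B'} (cs' : CoxeterSystem M' W) (x : W) : Set W :=
  {y | ∃ j : B', y⁻¹ * x * y = cs'.simple j}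

/-- The halfspace of the wall of the reflection `x` in the ambient Davis complex
containing the identity chamber. -/
noncomputable def Hplus {M' : CoxeterMatrix B'} (cs' : CoxeterSystem M' W) (x : W) :
    Set W :=
  {y | cs'.length y < cs'.length (x * y)}

/-- `(s, ω)` together with the marker `m` is a simple marking of the Coxeter system
`cs`: `ω` is a word in distinct letters distinct from `s`, `d(π ω · c₀, Y_s) = |ω|`,
the support `insert s {b | b ∈ ω}` is spherical, and adding the marker `m` to the
support gives a non-spherical set. -/
def IsSimpleMarking {M : CoxeterMatrix B} (cs : CoxeterSystem M W)
    (s : B) (ω : List B) (m : B) : Prop :=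
  ω.Nodup ∧ s ∉ ω ∧
    (∀ y : W, y ∈ IncidentWall cs (cs.simple s) →
      ω.length ≤ cs.length ((cs.wordProd ω)⁻¹ * y)) ∧
    (∃ y : W, y ∈ IncidentWall cs (cs.simple s) ∧
      cs.length ((cs.wordProd ω)⁻¹ * y) = ω.length) ∧
    SphericalIdx cs (insert s {b | b ∈ ω}) ∧
    ¬ SphericalIdx cs (insert m (insert s {b | b ∈ ω}))

/-- The set `K^μ_{s,t}` associated to a simple marking `μ = ((s, ω), m)` whose support
contains `t`: it is `J ∖ ({s,t} ∪ {s,t}^⊥)` if the support `J` is not `{s,t}`, and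
`{m}` otherwise. -/
noncomputable def Kst (M : CoxeterMatrix B) (s t : B) (ω : List B) (m : B) : Set B :=
  if (insert s {b | b ∈ ω} : Set B) = {s, t} then {m}
  else insert s {b | b ∈ ω} \ (({s, t} : Set B) ∪ perpIdx M {s, t})

/-! ### The geometric representation -/

/-- Entries of the cosine matrix (normalised so that roots have square norm 2). -/
noncomputable def gk (M : CoxeterMatrix B) (i j : B) : ℝ :=
  -2 * Real.cos (Real.pi / (M i j : ℝ))

theorem gk_symm (M : CoxeterMatrix B) (i j : B) : gk M i j = gk M j i := by
  rw [gk, gk, M.symmetric i j]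

theorem gk_self (M : CoxeterMatrix B) (i : B) : gk M i i = 2 := by
  simp [gk]

theorem gk_zero (M : CoxeterMatrix B) (i j : B) (h : M i j = 0) : gk M i j = -2 := by
  simp [gk, h]

theorem gk_nonpos (M : CoxeterMatrix B) (i j : B) (h : i ≠ j) : gk M i j ≤ 0 := by
  have h1 : M i j ≠ 1 := M.off_diagonal i j h
  have : 0 ≤ Real.cos (Real.pi / (M i j : ℝ)) := by
    rcases Nat.eq_zero_or_pos (M i j) with h0 | h0
    · simp [h0]
    · have h2 : (2 : ℝ) ≤ M i j := by
        have : 2 ≤ M i j := by omega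
        exact_mod_cast this
      have hpi := Real.pi_pos
      apply Real.cos_nonneg_of_mem_Icc
      constructor
      · have : 0 ≤ Real.pi / (M i j : ℝ) := by positivity
        linarith
      · exact div_le_div_of_nonneg_left hpi.le (by norm_num) h2
  rw [gk]; linarith

theorem gk_le_neg_one (M : CoxeterMatrix B) (i j : B) (h : i ≠ j) (h2 : M i j ≠ 2) :
    gk M i j ≤ -1 := by
  have h1 : M i j ≠ 1 := M.off_diagonal i j h
  have : 1 / 2 ≤ Real.cos (Real.pi / (M i j : ℝ)) := by
    rcases Nat.eq_zero_or_pos (M i j) with h0 | h0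
    · simp [h0]; norm_num
    · have h2 : (3 : ℝ) ≤ M i j := by
        have : 3 ≤ M i j := by omega
        exact_mod_cast this
      have hpi := Real.pi_pos
      rw [← Real.cos_pi_div_three]
      apply Real.cos_le_cos_of_nonneg_of_le_pi
      · positivity
      · linarith
      · exact div_le_div_of_nonneg_left hpi.le (by norm_num) h2
  rw [gk]; linarith

/-- The invariant bilinear form. -/
noncomputable def gform (M : CoxeterMatrix B) : (B →₀ ℝ) →ₗ[ℝ] (B →₀ ℝ) →ₗ[ℝ] ℝ :=
  Finsupp.linearCombination ℝ (fun i => Finsupp.linearCombination ℝ (fun j => gk M i j))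

theorem gform_single (M : CoxeterMatrix B) (i j : B) :
    gform M (Finsupp.single i 1) (Finsupp.single j 1) = gk M i j := by
  simp [gform]

theorem gform_symm (M : CoxeterMatrix B) (u v : B →₀ ℝ) : gform M u v = gform M v u := by
  have : gform M = (gform M).flip := by
    ext i j
    simp only [LinearMap.coe_comp, Function.comp_apply, Finsupp.lsingle_apply,
      LinearMap.flip_apply]
    rw [gform_single, gform_single, gk_symm]
  conv_lhs => rw [this]
  rfl

theorem gform_single_right (M : CoxeterMatrix B) (v : B →₀ ℝ) (j : B) :
    gform M v (Finsupp.single j 1) = v.sum (fun i c => c * gk M i j) := by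
  simp [gform, Finsupp.linearCombination_apply, Finsupp.sum]

theorem gform_single_self (M : CoxeterMatrix B) (i : B) :
    gform M (Finsupp.single i 1) (Finsupp.single i 1) = 2 := by
  rw [gform_single, gk_self]

/-- Simple reflections on the geometric representation. -/
noncomputable def grefl (M : CoxeterMatrix B) (i : B) : (B →₀ ℝ) ≃ₗ[ℝ] (B →₀ ℝ) :=
  Module.reflection (gform_single_self M i)

theorem grefl_apply (M : CoxeterMatrix B) (i : B) (v : B →₀ ℝ) :
    grefl M i v = v - gform M (Finsupp.single i 1) v • Finsupp.single i 1 :=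
  Module.reflection_apply (y := v) (gform_single_self M i)

theorem cheb_aux (m : ℕ) (hm : 3 ≤ m) (t : ℝ) (ht : t = 2 * Real.cos (2 * Real.pi / m)) :
    ((Polynomial.Chebyshev.S ℝ (((m : ℤ) - 2) / 2)).eval t *
      ((Polynomial.Chebyshev.S ℝ (((m : ℤ) - 1) / 2)).eval t +
        (Polynomial.Chebyshev.S ℝ (((m : ℤ) - 3) / 2)).eval t)) = 0 ∧
    ((Polynomial.Chebyshev.S ℝ (((m : ℤ) - 1) / 2)).eval t *
      ((Polynomial.Chebyshev.S ℝ ((m : ℤ) / 2)).eval t +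
        (Polynomial.Chebyshev.S ℝ (((m : ℤ) - 2) / 2)).eval t)) = 0 := by
  have hpi := Real.pi_pos
  have hm' : (3 : ℝ) ≤ m := by exact_mod_cast hm
  set θ : ℝ := 2 * Real.pi / m with hθ
  have hsin : 0 < Real.sin θ := by
    apply Real.sin_pos_of_pos_of_lt_pi
    · positivity
    · rw [hθ, div_lt_iff₀ (by linarith)]; nlinarith
  have hS : ∀ n : ℤ, (Polynomial.Chebyshev.S ℝ n).eval t * Real.sin θ
      = Real.sin ((n + 1) * θ) := by
    intro n; rw [ht]; exact Polynomial.Chebyshev.S_two_mul_real_cos _ _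
  have hz : ∀ n : ℤ, Real.sin ((n + 1) * θ) = 0 →
      (Polynomial.Chebyshev.S ℝ n).eval t = 0 := by
    intro n h
    have := hS n
    rw [h] at this
    rcases mul_eq_zero.1 this with h | h
    · exact h
    · exact absurd h hsin.ne'
  rcases Nat.even_or_odd' m with ⟨p, hp | hp⟩
  · have e1 : ((m : ℤ) - 2) / 2 = (p : ℤ) - 1 := by omega
    have e2 : ((m : ℤ) - 1) / 2 = (p : ℤ) - 1 := by omega
    have : (Polynomial.Chebyshev.S ℝ ((p : ℤ) - 1)).eval t = 0 := by
      apply hz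
      have : (((p : ℤ) - 1 : ℤ) + 1 : ℝ) * θ = Real.pi := by
        have hm0 : (m : ℝ) ≠ 0 := by linarith
        have : (m : ℝ) = 2 * p := by exact_mod_cast hp
        push_cast
        rw [hθ]
        field_simp
        rw [this]; ring
      rw [this, Real.sin_pi]
    rw [e1, e2, this]; simp
  · have e1 : ((m : ℤ) - 2) / 2 = (p : ℤ) - 1 := by omega
    have e2 : ((m : ℤ) - 1) / 2 = (p : ℤ) := by omega
    have e3 : ((m : ℤ) - 3) / 2 = (p : ℤ) - 1 := by omega
    have e4 : (m : ℤ) / 2 = (p : ℤ) := by omega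
    have key : (Polynomial.Chebyshev.S ℝ (p : ℤ)).eval t +
        (Polynomial.Chebyshev.S ℝ ((p : ℤ) - 1)).eval t = 0 := by
      have h1 := hS p
      have h2 := hS ((p : ℤ) - 1)
      have h3 : Real.sin (((p : ℤ) + 1 : ℝ) * θ) = - Real.sin ((((p : ℤ) - 1 : ℤ) + 1 : ℝ) * θ) := by
        have : (((p : ℤ) + 1 : ℝ) * θ) = 2 * Real.pi - ((((p : ℤ) - 1 : ℤ) + 1 : ℝ) * θ) := by
          have hm0 : (m : ℝ) ≠ 0 := by linarith
          have : (m : ℝ) = 2 * p + 1 := by exact_mod_cast hp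
          push_cast
          rw [hθ]
          field_simp
          rw [this]; ring
        rw [this, Real.sin_two_pi_sub]
      have h4 : ((Polynomial.Chebyshev.S ℝ (p : ℤ)).eval t +
        (Polynomial.Chebyshev.S ℝ ((p : ℤ) - 1)).eval t) * Real.sin θ = 0 := by
        rw [add_mul, h1, h2, h3]; ring
      rcases mul_eq_zero.1 h4 with h | h
      · exact h
      · exact absurd h hsin.ne'
    rw [e1, e2, e3, e4, key]; simp

theorem grefl_liftable (M : CoxeterMatrix B) : M.IsLiftable (grefl M) := by
  intro i j
  by_cases hij : i = j
  · subst hij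
    rw [M.diagonal, pow_one]
    exact inv_mul_cancel (grefl M i)
  have h1 : M i j ≠ 1 := M.off_diagonal i j hij
  rcases Nat.lt_or_ge (M i j) 3 with h | h
  · have : M i j = 0 ∨ M i j = 2 := by omega
    rcases this with h | h
    · rw [h, pow_zero]
    · have hk : gk M i j = 0 := by simp [gk, h]
      have hk' : gk M j i = 0 := by rw [gk_symm, hk]
      rw [h]
      ext v : 1
      simp only [pow_two, LinearEquiv.mul_apply, grefl_apply, map_sub, map_smul, gform_single,
        gk_self, hk, hk', LinearEquiv.coe_one, id]
      module
  · ext1 v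
    have hc := cheb_aux (M i j) h
      (gform M (Finsupp.single i 1) (Finsupp.single j 1) *
        gform M (Finsupp.single j 1) (Finsupp.single i 1) - 2) (by
        rw [gform_single, gform_single, gk_symm M j i, gk]
        have : (2 * Real.pi / (M i j : ℝ)) = 2 * (Real.pi / (M i j : ℝ)) := by ring
        rw [this, Real.cos_two_mul]; ring)
    have := Module.reflection_mul_reflection_pow_apply (gform_single_self M i)
      (gform_single_self M j) (M i j) v
    rw [hc.1, hc.2] at this
    rw [zero_smul, zero_smul, add_zero, add_zero] at this
    exact this

/-- The geometric representation. -/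
noncomputable def grep {M : CoxeterMatrix B} (cs : CoxeterSystem M W) :
    W →* ((B →₀ ℝ) ≃ₗ[ℝ] (B →₀ ℝ)) :=
  cs.lift ⟨grefl M, grefl_liftable M⟩

theorem grep_simple {M : CoxeterMatrix B} (cs : CoxeterSystem M W) (i : B) :
    grep cs (cs.simple i) = grefl M i :=
  cs.lift_apply_simple (grefl_liftable M) i

theorem grefl_form (M : CoxeterMatrix B) (i : B) (u v : B →₀ ℝ) :
    gform M (grefl M i u) (grefl M i v) = gform M u v := by
  simp only [grefl_apply, map_sub, map_smul, LinearMap.sub_apply, LinearMap.smul_apply,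
    gform_single_self, smul_eq_mul]
  rw [gform_symm M u (Finsupp.single i 1)]
  ring

theorem grep_form {M : CoxeterMatrix B} (cs : CoxeterSystem M W) (w : W) (u v : B →₀ ℝ) :
    gform M (grep cs w u) (grep cs w v) = gform M u v := by
  induction w using cs.simple_induction_left with
  | one => simp
  | mul_simple_left w i ih =>
    rw [map_mul, LinearEquiv.mul_apply, LinearEquiv.mul_apply, grep_simple, grefl_form, ih]

theorem gsimple_injective {M : CoxeterMatrix B} (cs : CoxeterSystem M W) :
    Function.Injective cs.simple := by
  intro a b h
  by_contra hab
  have h1 : grefl M a (Finsupp.single a 1) = grefl M b (Finsupp.single a 1) := by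
    rw [← grep_simple cs, ← grep_simple cs, h]
  have h2 := DFunLike.congr_fun h1 a
  rw [grefl_apply, grefl_apply] at h2
  simp [gform_single, gk_self, Ne.symm hab] at h2

/-- If the root `w⁻¹ α_s` does not involve `m` and pairs with `α_m` to at most `-2`, then
`s` and `w m w⁻¹` generate an infinite dihedral group. -/
theorem infinite_of_form {M : CoxeterMatrix B} (cs : CoxeterSystem M W) (s m : B) (w : W)
    (hm0 : grep cs w⁻¹ (Finsupp.single s 1) m = 0)
    (hform : gform M (grep cs w⁻¹ (Finsupp.single s 1)) (Finsupp.single m 1) ≤ -2)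
    (n : ℕ) (hn : n ≠ 0) : (cs.simple s * (w * cs.simple m * w⁻¹)) ^ n ≠ 1 := by
  intro h
  set β := grep cs w⁻¹ (Finsupp.single s 1) with hβ
  set α : B →₀ ℝ := Finsupp.single m 1 with hα
  set c := - gform M β α with hc
  have hc2 : 2 ≤ c := by linarith
  have hββ : gform M β β = 2 := by
    rw [hβ, grep_form, gform_single_self]
  have hr : ∀ v, grep cs (w⁻¹ * cs.simple s * w) v = v - gform M β v • β := by
    intro v
    rw [map_mul, map_mul, LinearEquiv.mul_apply, LinearEquiv.mul_apply, grep_simple, grefl_apply,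
      map_sub, map_smul, ← hβ]
    congr 2
    · rw [← LinearEquiv.mul_apply, ← map_mul]; simp
    · have := grep_form cs w β v
      rw [← this, hβ, ← LinearEquiv.mul_apply, ← map_mul]; simp
  have hconj : (w⁻¹ * cs.simple s * w * cs.simple m) ^ n = 1 := by
    have e : w⁻¹ * cs.simple s * w * cs.simple m
        = w⁻¹ * (cs.simple s * (w * cs.simple m * w⁻¹)) * (w⁻¹)⁻¹ := by group
    rw [e, conj_pow, h]; simp
  have hseq : ∀ k : ℕ, ∃ p q : ℝ, 1 ≤ p ∧ q < p ∧ 0 ≤ q ∧ (k ≠ 0 → 1 ≤ q) ∧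
      grep cs ((w⁻¹ * cs.simple s * w * cs.simple m) ^ k) β = p • β + q • α := by
    intro k
    induction k with
    | zero => exact ⟨1, 0, le_refl _, by norm_num, le_refl _, by simp, by simp⟩
    | succ k ih =>
      obtain ⟨p, q, hp, hqp, hq, -, e⟩ := ih
      have hq1 : p < p * c - q := by nlinarith
      have hp1 : p * c - q < (p * c - q) * c - p := by nlinarith
      refine ⟨(p * c - q) * c - p, p * c - q, ?_, ?_, ?_, ?_, ?_⟩
      · linarith
      · linarith
      · linarith
      · intro _; linarith
      · rw [pow_succ', map_mul, LinearEquiv.mul_apply, e, map_mul, LinearEquiv.mul_apply,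
          grep_simple, grefl_apply, ← hα, hr]
        have h1 : gform M α β = -c := by rw [gform_symm, hc]; ring
        have h2 : gform M β α = -c := by rw [hc]; ring
        have h3 : gform M α α = 2 := gform_single_self M m
        simp only [map_add, map_sub, map_smul, h1, h2, h3, hββ, smul_eq_mul]
        module
  obtain ⟨p, q, -, -, -, hq, e⟩ := hseq n
  rw [hconj] at e
  have e2 := DFunLike.congr_fun e m
  simp [hm0, hα] at e2
  have := hq hn
  linarith
/-! ### Words in which every letter fails to commute with an earlier one -/

/-- The support of a word with core `s`. -/
def supp (s : B) (ω : List B) : Set B := insert s {b | b ∈ ω}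

theorem supp_snoc (s : B) (ω : List B) (l : B) : supp s (ω ++ [l]) = insert l (supp s ω) := by
  ext x; simp only [supp, Set.mem_insert_iff, Set.mem_setOf_eq, List.mem_append,
    List.mem_singleton]; tauto

theorem core_mem_supp (s : B) (ω : List B) : s ∈ supp s ω := Set.mem_insert _ _

/-- A good word. -/
inductive Good (M : CoxeterMatrix B) (s : B) : List B → Prop
  | nil : Good M s []
  | snoc (ω : List B) (l : B) : Good M s ω → l ∉ supp s ω → (∃ e ∈ supp s ω, M e l ≠ 2) →
      Good M s (ω ++ [l])

theorem good_snoc_iff (M : CoxeterMatrix B) (s : B) (ω : List B) (l : B) :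
    Good M s (ω ++ [l]) ↔ Good M s ω ∧ l ∉ supp s ω ∧ ∃ e ∈ supp s ω, M e l ≠ 2 := by
  constructor
  · intro h
    generalize hx : ω ++ [l] = x at h
    cases h with
    | nil => simp at hx
    | snoc ω' l' h1 h2 h3 =>
      obtain ⟨rfl, h⟩ := List.append_inj' hx rfl
      simp at h; subst h
      exact ⟨h1, h2, h3⟩
  · rintro ⟨h1, h2, h3⟩
    exact Good.snoc _ _ h1 h2 h3

/-- Pairwise adjacency. -/
def Clq (M : CoxeterMatrix B) (J : Set B) : Prop := ∀ a ∈ J, ∀ b ∈ J, a ≠ b → M a b ≠ 0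

theorem gform_le_one (M : CoxeterMatrix B) (v : B →₀ ℝ) (l e : B) (hv : ∀ b, 0 ≤ v b)
    (hl : v l = 0) (he : 1 ≤ v e) : gform M v (Finsupp.single l 1) ≤ gk M e l := by
  have hel : e ≠ l := by rintro rfl; linarith
  rw [gform_single_right, Finsupp.sum]
  have hmem : e ∈ v.support := by rw [Finsupp.mem_support_iff]; linarith
  rw [← Finset.add_sum_erase _ _ hmem]
  have h1 : v e * gk M e l ≤ gk M e l := by
    have := gk_nonpos M e l hel; nlinarith
  have h2 : ∑ x ∈ v.support.erase e, v x * gk M x l ≤ 0 := by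
    apply Finset.sum_nonpos
    intro x hx
    by_cases hxl : x = l
    · subst hxl; rw [hl]; simp
    · exact mul_nonpos_of_nonneg_of_nonpos (hv x) (gk_nonpos M x l hxl)
  linarith

theorem gform_le_two (M : CoxeterMatrix B) (v : B →₀ ℝ) (l e f : B) (hv : ∀ b, 0 ≤ v b)
    (hl : v l = 0) (he : 1 ≤ v e) (hf : 1 ≤ v f) (hef : e ≠ f) :
    gform M v (Finsupp.single l 1) ≤ gk M e l + gk M f l := by
  have hel : e ≠ l := by rintro rfl; linarith
  have hfl : f ≠ l := by rintro rfl; linarith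
  rw [gform_single_right, Finsupp.sum]
  have hmem : e ∈ v.support := by rw [Finsupp.mem_support_iff]; linarith
  have hmem' : f ∈ v.support.erase e := by
    rw [Finset.mem_erase, Finsupp.mem_support_iff]; exact ⟨hef.symm, by linarith⟩
  rw [← Finset.add_sum_erase _ _ hmem, ← Finset.add_sum_erase _ _ hmem']
  have h1 : v e * gk M e l ≤ gk M e l := by
    have := gk_nonpos M e l hel; nlinarith
  have h1' : v f * gk M f l ≤ gk M f l := by
    have := gk_nonpos M f l hfl; nlinarith
  have h2 : ∑ x ∈ (v.support.erase e).erase f, v x * gk M x l ≤ 0 := by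
    apply Finset.sum_nonpos
    intro x hx
    by_cases hxl : x = l
    · subst hxl; rw [hl]; simp
    · exact mul_nonpos_of_nonneg_of_nonpos (hv x) (gk_nonpos M x l hxl)
  linarith

theorem root_coeff {M : CoxeterMatrix B} (cs : CoxeterSystem M W) (s : B) (ω : List B)
    (h : Good M s ω) :
    (∀ b ∈ supp s ω, 1 ≤ grep cs (cs.wordProd ω)⁻¹ (Finsupp.single s 1) b) ∧
    (∀ b, b ∉ supp s ω → grep cs (cs.wordProd ω)⁻¹ (Finsupp.single s 1) b = 0) := by
  induction h with
  | nil =>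
    constructor
    · intro b hb
      simp [supp] at hb
      subst hb; simp
    · intro b hb
      simp [supp] at hb
      simp [Ne.symm hb]
  | snoc ω l h1 h2 h3 ih =>
    obtain ⟨ih1, ih2⟩ := ih
    obtain ⟨e, he, hel⟩ := h3
    set β := grep cs (cs.wordProd ω)⁻¹ (Finsupp.single s 1) with hβ
    have hnn : ∀ b, 0 ≤ β b := by
      intro b
      by_cases hb : b ∈ supp s ω
      · linarith [ih1 b hb]
      · rw [ih2 b hb]
    have hne : e ≠ l := by rintro rfl; exact h2 he
    have hform : gform M β (Finsupp.single l 1) ≤ -1 :=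
      (gform_le_one M β l e hnn (ih2 l h2) (ih1 e he)).trans (gk_le_neg_one M e l hne hel)
    have key : grep cs (cs.wordProd (ω ++ [l]))⁻¹ (Finsupp.single s 1)
        = β - gform M β (Finsupp.single l 1) • Finsupp.single l 1 := by
      rw [cs.wordProd_append, cs.wordProd_singleton, mul_inv_rev, cs.inv_simple, map_mul,
        LinearEquiv.mul_apply, grep_simple, grefl_apply, gform_symm M (Finsupp.single l 1)]
    rw [key, supp_snoc]
    constructor
    · intro b hb
      by_cases hbl : b = l
      · subst hbl
        simp [ih2 b h2]; linarith
      · have := ih1 b (by simpa [hbl] using hb)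
        simpa [Ne.symm hbl] using this
    · intro b hb
      simp only [Set.mem_insert_iff, not_or] at hb
      simp [ih2 b hb.2, Ne.symm hb.1]

theorem infinite_of_zero {M : CoxeterMatrix B} (cs : CoxeterSystem M W) (s : B) (ω : List B)
    (h : Good M s ω) (m e : B) (hm : m ∉ supp s ω) (he : e ∈ supp s ω) (hem : M e m = 0)
    (n : ℕ) (hn : n ≠ 0) :
    (cs.simple s * (cs.wordProd ω * cs.simple m * (cs.wordProd ω)⁻¹)) ^ n ≠ 1 := by
  obtain ⟨h1, h2⟩ := root_coeff cs s ω h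
  refine infinite_of_form cs s m _ (h2 m hm) ?_ n hn
  rw [← gk_zero M e m hem]
  refine gform_le_one M _ m e ?_ (h2 m hm) (h1 e he)
  intro b
  by_cases hb : b ∈ supp s ω
  · linarith [h1 b hb]
  · rw [h2 b hb]

theorem infinite_of_two {M : CoxeterMatrix B} (cs : CoxeterSystem M W) (s : B) (ω : List B)
    (h : Good M s ω) (m e f : B) (hm : m ∉ supp s ω) (he : e ∈ supp s ω) (hf : f ∈ supp s ω)
    (hef : e ≠ f) (hem : M e m ≠ 2) (hfm : M f m ≠ 2)
    (n : ℕ) (hn : n ≠ 0) :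
    (cs.simple s * (cs.wordProd ω * cs.simple m * (cs.wordProd ω)⁻¹)) ^ n ≠ 1 := by
  obtain ⟨h1, h2⟩ := root_coeff cs s ω h
  refine infinite_of_form cs s m _ (h2 m hm) ?_ n hn
  have a1 := gk_le_neg_one M e m (by rintro rfl; exact hm he) hem
  have a2 := gk_le_neg_one M f m (by rintro rfl; exact hm hf) hfm
  refine le_trans (gform_le_two M _ m e f ?_ (h2 m hm) (h1 e he) (h1 f hf) hef) (by linarith)
  intro b
  by_cases hb : b ∈ supp s ω
  · linarith [h1 b hb]
  · rw [h2 b hb]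

theorem clq_of_spherical {M : CoxeterMatrix B} (cs : CoxeterSystem M W) (J : Set B)
    (h : SphericalIdx cs J) : Clq M J := by
  intro a ha b hb hab h0
  have hinf := infinite_of_zero cs a [] Good.nil b a (by simp [supp, Ne.symm hab])
    (core_mem_supp _ _) h0
  have hfin : Finite (Subgroup.closure (cs.simple '' J)) := h
  let g : Subgroup.closure (cs.simple '' J) :=
    ⟨cs.simple a * cs.simple b, mul_mem (Subgroup.subset_closure ⟨a, ha, rfl⟩)
      (Subgroup.subset_closure ⟨b, hb, rfl⟩)⟩
  obtain ⟨n, hn, hg⟩ := (isOfFinOrder_of_finite g).exists_pow_eq_one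
  apply hinf n hn.ne'
  have := congrArg Subtype.val hg
  simpa [g] using this

theorem wordProd_mem_closure {M : CoxeterMatrix B} (cs : CoxeterSystem M W) (J : Set B)
    (ω : List B) (h : ∀ b ∈ ω, b ∈ J) :
    cs.wordProd ω ∈ Subgroup.closure (cs.simple '' J) := by
  induction ω with
  | nil => simp [one_mem]
  | cons a ω ih =>
    rw [cs.wordProd_cons]
    exact mul_mem (Subgroup.subset_closure ⟨a, h a (by simp), rfl⟩)
      (ih (fun b hb => h b (by simp [hb])))

/-- The Coxeter diagram of a spherical clique has no cycles. -/
theorem tree_lemma {M : CoxeterMatrix B} (cs : CoxeterSystem M W) (hFC : IsFC cs) (s : B)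
    (ω : List B) (l e f : B) (h : Good M s ω) (hl : l ∉ supp s ω)
    (hc : Clq M (insert l (supp s ω))) (he : e ∈ supp s ω) (hf : f ∈ supp s ω)
    (hem : M e l ≠ 2) (hfm : M f l ≠ 2) : e = f := by
  by_contra hef
  have hinf := infinite_of_two cs s ω h l e f hl he hf hef hem hfm
  have hfin : Finite (Subgroup.closure (cs.simple '' (insert l (supp s ω)))) := hFC _ hc
  have hw : cs.wordProd ω ∈ Subgroup.closure (cs.simple '' (insert l (supp s ω))) :=
    wordProd_mem_closure cs _ ω (fun b hb => Or.inr (Or.inr hb))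
  let g : Subgroup.closure (cs.simple '' (insert l (supp s ω))) :=
    ⟨cs.simple s * (cs.wordProd ω * cs.simple l * (cs.wordProd ω)⁻¹),
      mul_mem (Subgroup.subset_closure ⟨s, Or.inr (core_mem_supp _ _), rfl⟩)
        (mul_mem (mul_mem hw (Subgroup.subset_closure ⟨l, Or.inl rfl, rfl⟩)) (inv_mem hw))⟩
  obtain ⟨n, hn, hg⟩ := (isOfFinOrder_of_finite g).exists_pow_eq_one
  apply hinf n hn.ne'
  have := congrArg Subtype.val hg
  simpa [g] using this

theorem simple_comm {M : CoxeterMatrix B} (cs : CoxeterSystem M W) (a b : B) (h : M a b = 2) :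
    cs.simple a * cs.simple b = cs.simple b * cs.simple a := by
  have := cs.simple_mul_simple_pow a b
  rw [h, pow_two] at this
  have h2 := eq_inv_of_mul_eq_one_left this
  rw [mul_inv_rev, cs.inv_simple, cs.inv_simple] at h2
  exact h2

theorem wordProd_comm {M : CoxeterMatrix B} (cs : CoxeterSystem M W) (l : B) (β : List B)
    (h : ∀ b ∈ β, M b l = 2) : cs.simple l * cs.wordProd β = cs.wordProd β * cs.simple l := by
  induction β with
  | nil => simp
  | cons b β ih =>
    rw [cs.wordProd_cons, ← mul_assoc, ← simple_comm cs b l (h b (by simp)), mul_assoc,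
      ih (fun b hb => h b (by simp [hb])), mul_assoc]

theorem good_append_iff (M : CoxeterMatrix B) (s : B) (α β : List B) :
    Good M s (α ++ β) ↔ Good M s α ∧ ∀ β₁ l β₂, β = β₁ ++ l :: β₂ →
      l ∉ supp s (α ++ β₁) ∧ ∃ e ∈ supp s (α ++ β₁), M e l ≠ 2 := by
  induction β using List.reverseRecOn with
  | nil => simp
  | append_singleton β x ih =>
    rw [← List.append_assoc, good_snoc_iff, ih]
    constructor
    · rintro ⟨⟨h1, h2⟩, h3⟩
      refine ⟨h1, ?_⟩
      intro β₁ l β₂ he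
      rcases List.eq_nil_or_concat' β₂ with rfl | ⟨γ, y, rfl⟩
      · obtain ⟨rfl, h⟩ := List.append_inj' he rfl
        simp at h; subst h
        exact h3
      · have : β ++ [x] = (β₁ ++ l :: γ) ++ [y] := by simpa using he
        obtain ⟨rfl, -⟩ := List.append_inj' this rfl
        exact h2 _ _ _ rfl
    · rintro ⟨h1, h2⟩
      refine ⟨⟨h1, ?_⟩, h2 β x [] rfl⟩
      rintro β₁ l β₂ rfl
      exact h2 β₁ l (β₂ ++ [x]) (by simp)

theorem good_nodup (M : CoxeterMatrix B) (s : B) (ω : List B) (h : Good M s ω) :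
    ω.Nodup ∧ s ∉ ω := by
  induction h with
  | nil => simp
  | snoc ω l h1 h2 h3 ih =>
    simp only [supp, Set.mem_insert_iff, Set.mem_setOf_eq, not_or] at h2
    constructor
    · rw [List.nodup_append]
      refine ⟨ih.1, by simp, ?_⟩
      intro a ha b hb
      simp at hb; subst hb
      rintro rfl; exact h2.2 ha
    · simp only [List.mem_append, List.mem_singleton, not_or]
      exact ⟨ih.2, fun h => h2.1 h.symm⟩

/-- Good words with the same support represent the same element. -/
theorem good_unique {M : CoxeterMatrix B} (cs : CoxeterSystem M W) (hFC : IsFC cs) (s : B)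
    (ω : List B) (h : Good M s ω) : ∀ ω' : List B, Good M s ω' → supp s ω = supp s ω' →
      Clq M (supp s ω) → cs.wordProd ω = cs.wordProd ω' := by
  induction h with
  | nil =>
    intro ω' h' he _
    have : ω' = [] := by
      by_contra hne
      obtain ⟨x, hx⟩ := List.exists_mem_of_ne_nil _ hne
      have : x ∈ supp s ([] : List B) := by rw [he]; exact Or.inr hx
      simp [supp] at this
      subst this
      exact (good_nodup M x ω' h').2 hx
    rw [this]
  | snoc ω l h1 h2 h3 ih =>
    intro ω' h' he hc
    have hls : l ≠ s := by rintro rfl; exact h2 (core_mem_supp _ _)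
    have hl' : l ∈ ω' := by
      have : l ∈ supp s ω' := by rw [← he, supp_snoc]; exact Or.inl rfl
      rcases this with h | h
      · exact absurd h hls
      · exact h
    obtain ⟨α, β, rfl⟩ := List.append_of_mem hl'
    obtain ⟨hα, hβ⟩ := (good_append_iff M s α (l :: β)).1 h'
    obtain ⟨hnd, hs⟩ := good_nodup M s _ h'
    have hsub : ∀ x, x ≠ l → x ∈ supp s (α ++ l :: β) → x ∈ supp s ω := by
      intro x hx hx'
      rw [← he, supp_snoc] at hx'
      exact hx'.resolve_left hx
    obtain ⟨hl1, e, he1, he2⟩ := hβ [] l β rfl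
    simp only [List.append_nil] at hl1 he1
    have heω : e ∈ supp s ω := by
      apply hsub
      · rintro rfl; exact hl1 he1
      · rcases he1 with h | h
        · exact Or.inl h
        · right; simp at h ⊢; left; exact h
    have hlβ : l ∉ β := by
      rw [List.nodup_append] at hnd
      exact (List.nodup_cons.1 hnd.2.1).1
    have hcomm : ∀ b ∈ β, M b l = 2 := by
      intro b hb
      by_contra hb2
      have hbω : b ∈ supp s ω := by
        apply hsub
        · rintro rfl; exact hlβ hb
        · right; simp [hb]
      have := tree_lemma cs hFC s ω l e b h1 h2 (by rw [← supp_snoc]; exact hc) heω hbω he2 hb2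
      subst this
      rcases he1 with h | h
      · subst h; apply hs; simp [hb]
      · rw [List.nodup_append] at hnd
        exact hnd.2.2 e h e (by simp [hb]) rfl
    have hgood : Good M s (α ++ β) := by
      rw [good_append_iff]
      refine ⟨hα, ?_⟩
      rintro β₁ x β₂ rfl
      obtain ⟨g1, f, g2, g3⟩ := hβ (l :: β₁) x β₂ rfl
      constructor
      · intro hx; apply g1
        rcases hx with h | h
        · exact Or.inl h
        · right; simp at h ⊢; tauto
      · refine ⟨f, ?_, g3⟩
        rcases g2 with h | h
        · exact Or.inl h
        · simp at h
          rcases h with h | h | h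
          · right; simp [h]
          · subst h
            exact absurd ((M.symmetric _ _).trans (hcomm x (by simp))) g3
          · right; simp [h]
    have hsupp : supp s ω = supp s (α ++ β) := by
      ext x
      have hx : x ∈ supp s (ω ++ [l]) ↔ x ∈ supp s (α ++ l :: β) := by rw [he]
      rw [supp_snoc] at hx
      by_cases hxl : x = l
      · subst hxl
        constructor
        · intro h; exact absurd h h2
        · intro h
          rcases h with h | h
          · exact absurd h hls
          · simp at h
            rcases h with h | h
            · exact absurd (Or.inr h) hl1
            · exact absurd h hlβ
      · simp only [Set.mem_insert_iff, hxl, false_or] at hx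
        rw [hx]
        simp [supp, hxl]
    have := ih (α ++ β) hgood hsupp (fun a ha b hb => hc a (by rw [supp_snoc]; exact Or.inr ha) b
      (by rw [supp_snoc]; exact Or.inr hb))
    rw [cs.wordProd_append, cs.wordProd_singleton, this, cs.wordProd_append, cs.wordProd_append,
      cs.wordProd_cons, wordProd_comm cs l β hcomm, mul_assoc]
/-! ### The exchange condition and half-spaces in the ambient complex -/

/-- The permutation of `W × ZMod 2` attached to a simple reflection. -/
noncomputable def exPerm {M : CoxeterMatrix B} (cs : CoxeterSystem M W) (i : B) :
    Equiv.Perm (W × ZMod 2) :=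
  Function.Involutive.toPerm
    (fun p => (cs.simple i * p.1 * cs.simple i, p.2 + if p.1 = cs.simple i then 1 else 0)) (by
      rintro ⟨t, e⟩
      have h : cs.simple i * t * cs.simple i = cs.simple i ↔ t = cs.simple i := by
        constructor
        · intro h
          have h2 : cs.simple i * t = 1 := by
            have := congrArg (· * cs.simple i) h
            simpa using this
          have h3 := eq_inv_of_mul_eq_one_right h2
          simpa using h3
        · rintro rfl; simp
      ext1
      · simp [mul_assoc]
      · simp only [h]
        split_ifs
        · rw [add_assoc]; have : (1 : ZMod 2) + 1 = 0 := by decide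
          rw [this, add_zero]
        · simp)

theorem exPerm_apply {M : CoxeterMatrix B} (cs : CoxeterSystem M W) (i : B) (t : W)
    (e : ZMod 2) : exPerm cs i (t, e) =
      (cs.simple i * t * cs.simple i, e + if t = cs.simple i then 1 else 0) := rfl

theorem dih_aux {M : CoxeterMatrix B} (cs : CoxeterSystem M W) (i j : B) (k : ℕ) :
    cs.simple j * (cs.simple i * cs.simple j) ^ k =
      ((cs.simple i * cs.simple j)⁻¹) ^ k * cs.simple j := by
  induction k with
  | zero => simp
  | succ k ih =>
    rw [pow_succ, ← mul_assoc, ih, pow_succ, mul_inv_rev, cs.inv_simple, cs.inv_simple]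
    simp [mul_assoc]

theorem exPerm_pow {M : CoxeterMatrix B} (cs : CoxeterSystem M W) (i j : B) (n : ℕ) (t : W)
    (e : ZMod 2) : ((exPerm cs i * exPerm cs j) ^ n) (t, e) =
      ((cs.simple i * cs.simple j) ^ n * t * ((cs.simple i * cs.simple j) ^ n)⁻¹,
        e + ∑ k ∈ Finset.range (2 * n),
          if t = ((cs.simple i * cs.simple j)⁻¹) ^ k * cs.simple j then (1 : ZMod 2) else 0) := by
  induction n with
  | zero => simp
  | succ n ih =>
    rw [pow_succ', Equiv.Perm.mul_apply, ih, Equiv.Perm.mul_apply, exPerm_apply, exPerm_apply]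
    set q := cs.simple i * cs.simple j with hq
    have hqi : q⁻¹ = cs.simple j * cs.simple i := by
      rw [hq, mul_inv_rev, cs.inv_simple, cs.inv_simple]
    have e1 : q ^ n * t * (q ^ n)⁻¹ = cs.simple j ↔ t = q⁻¹ ^ (2 * n) * cs.simple j := by
      have h1 : q⁻¹ ^ (2 * n) * cs.simple j = (q ^ n)⁻¹ * cs.simple j * q ^ n := by
        rw [mul_assoc, dih_aux cs i j n, two_mul, pow_add, ← inv_pow, mul_assoc]
      rw [h1]
      constructor
      · intro h; rw [← h]; group
      · intro h; rw [h]; group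
    have e2 : cs.simple j * (q ^ n * t * (q ^ n)⁻¹) * cs.simple j = cs.simple i ↔
        t = q⁻¹ ^ (2 * n + 1) * cs.simple j := by
      have h1 : q⁻¹ ^ (2 * n + 1) * cs.simple j
          = (q ^ n)⁻¹ * (cs.simple j * cs.simple i * cs.simple j) * q ^ n := by
        rw [mul_assoc, mul_assoc _ (cs.simple j), dih_aux cs i j n, ← hqi, ← mul_assoc, ← mul_assoc,
          ← inv_pow]
        congr 1
        rw [← pow_succ, ← pow_add]
        congr 1; ring
      rw [h1]
      constructor
      · intro h; rw [← h]
        simp only [mul_assoc, cs.simple_mul_simple_cancel_left, cs.simple_mul_simple_self]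
        group
      · intro h; rw [h]
        have : q ^ n * ((q ^ n)⁻¹ * (cs.simple j * cs.simple i * cs.simple j) * q ^ n) * (q ^ n)⁻¹
          = cs.simple j * cs.simple i * cs.simple j := by group
        rw [this]
        simp [mul_assoc]
    ext1
    · simp only [pow_succ', mul_inv_rev, hqi]
      rw [hq]; simp only [mul_assoc]
    · simp only [e1, e2]
      rw [show 2 * (n + 1) = 2 * n + 1 + 1 by ring, Finset.sum_range_succ, Finset.sum_range_succ]
      ring

theorem exPerm_liftable {M : CoxeterMatrix B} (cs : CoxeterSystem M W) :
    M.IsLiftable (exPerm cs) := by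
  intro i j
  ext1 ⟨t, e⟩
  rw [exPerm_pow, cs.simple_mul_simple_pow]
  have : ∑ k ∈ Finset.range (2 * M i j),
      (if t = ((cs.simple i * cs.simple j)⁻¹) ^ k * cs.simple j then (1 : ZMod 2) else 0) = 0 := by
    rw [two_mul, Finset.sum_range_add]
    have : ∀ k, ((cs.simple i * cs.simple j)⁻¹) ^ (M i j + k) =
        ((cs.simple i * cs.simple j)⁻¹) ^ k := by
      intro k
      rw [pow_add, inv_pow, cs.simple_mul_simple_pow]; simp
    simp only [this]
    generalize (∑ k ∈ Finset.range (M i j), _ : ZMod 2) = z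
    revert z; decide
  rw [this]; simp

/-- The action of `W` on `W × ZMod 2`. -/
noncomputable def exRep {M : CoxeterMatrix B} (cs : CoxeterSystem M W) :
    W →* Equiv.Perm (W × ZMod 2) := cs.lift ⟨exPerm cs, exPerm_liftable cs⟩

/-- The inversion cocycle. -/
noncomputable def eta {M : CoxeterMatrix B} (cs : CoxeterSystem M W) (w t : W) : ZMod 2 :=
  (exRep cs w (t, 0)).2

theorem exRep_word {M : CoxeterMatrix B} (cs : CoxeterSystem M W) (ω : List B) (t : W)
    (e : ZMod 2) : exRep cs (cs.wordProd ω) (t, e) =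
      (cs.wordProd ω * t * (cs.wordProd ω)⁻¹, e + ((cs.rightInvSeq ω).count t : ℕ)) := by
  induction ω with
  | nil => simp
  | cons i ω ih =>
    rw [cs.wordProd_cons, map_mul, Equiv.Perm.mul_apply, ih]
    have : exRep cs (cs.simple i) = exPerm cs i := cs.lift_apply_simple (exPerm_liftable cs) i
    rw [this, exPerm_apply]
    ext1
    · simp [mul_assoc]
    · have h : cs.wordProd ω * t * (cs.wordProd ω)⁻¹ = cs.simple i ↔
          (cs.wordProd ω)⁻¹ * cs.simple i * cs.wordProd ω = t := by
        constructor
        · intro h; rw [← h]; group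
        · intro h; rw [← h]; group
      simp only [CoxeterSystem.rightInvSeq, List.count_cons, h, beq_iff_eq]
      split_ifs <;> simp [add_assoc]

theorem eta_word {M : CoxeterMatrix B} (cs : CoxeterSystem M W) (ω : List B) (t : W) :
    eta cs (cs.wordProd ω) t = ((cs.rightInvSeq ω).count t : ℕ) := by
  rw [eta, exRep_word]; simp

theorem exRep_apply {M : CoxeterMatrix B} (cs : CoxeterSystem M W) (w t : W) (e : ZMod 2) :
    exRep cs w (t, e) = (w * t * w⁻¹, e + eta cs w t) := by
  obtain ⟨ω, rfl⟩ := cs.wordProd_surjective w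
  rw [exRep_word, eta_word]

theorem eta_mul {M : CoxeterMatrix B} (cs : CoxeterSystem M W) (v w t : W) :
    eta cs (v * w) t = eta cs w t + eta cs v (w * t * w⁻¹) := by
  have h := exRep_apply cs (v * w) t 0
  rw [map_mul, Equiv.Perm.mul_apply, exRep_apply, exRep_apply] at h
  have := congrArg Prod.snd h
  simpa using this.symm

theorem eta_one {M : CoxeterMatrix B} (cs : CoxeterSystem M W) (t : W) : eta cs 1 t = 0 := by
  simp [eta]

theorem eta_simple {M : CoxeterMatrix B} (cs : CoxeterSystem M W) (i : B) (t : W) :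
    eta cs (cs.simple i) t = if t = cs.simple i then 1 else 0 := by
  have := eta_word cs [i] t
  rw [cs.wordProd_singleton] at this
  rw [this]
  simp only [CoxeterSystem.rightInvSeq_singleton, List.count_singleton, beq_iff_eq]
  by_cases h : t = cs.simple i
  · simp [h]
  · simp [h, Ne.symm h]

theorem eta_refl {M : CoxeterMatrix B} (cs : CoxeterSystem M W) (t : W)
    (ht : cs.IsReflection t) : eta cs t t = 1 := by
  obtain ⟨w, i, rfl⟩ := ht
  have h1 := eta_mul cs w w⁻¹ (w * cs.simple i * w⁻¹)
  rw [mul_inv_cancel, eta_one] at h1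
  rw [eta_mul cs (w * cs.simple i) w⁻¹, eta_mul cs w (cs.simple i)]
  have e1 : w⁻¹ * (w * cs.simple i * w⁻¹) * w⁻¹⁻¹ = cs.simple i := by group
  rw [e1] at h1 ⊢
  have e2 : cs.simple i * cs.simple i * (cs.simple i)⁻¹ = cs.simple i := by simp
  rw [e2, eta_simple, if_pos rfl]
  have : ∀ a b : ZMod 2, 0 = a + b → a + (1 + b) = 1 := by decide
  exact this _ _ h1

theorem lt_of_eta {M : CoxeterMatrix B} (cs : CoxeterSystem M W) (w t : W)
    (h : eta cs w t ≠ 0) : cs.length (w * t) < cs.length w := by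
  obtain ⟨ω, hr, rfl⟩ := cs.exists_isReduced w
  rw [eta_word] at h
  have : t ∈ cs.rightInvSeq ω := by
    by_contra hn
    rw [List.count_eq_zero_of_not_mem hn] at h
    simp at h
  exact (cs.isRightInversion_of_mem_rightInvSeq hr this).2

theorem eta_ne_zero_iff {M : CoxeterMatrix B} (cs : CoxeterSystem M W) (w t : W)
    (ht : cs.IsReflection t) : eta cs w t ≠ 0 ↔ cs.length (w * t) < cs.length w := by
  refine ⟨lt_of_eta cs w t, ?_⟩
  intro h h0
  have h1 := eta_mul cs w t t
  rw [eta_refl cs t ht, ht.inv, mul_assoc, ht.mul_self, mul_one, h0, add_zero] at h1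
  have := lt_of_eta cs (w * t) t (by rw [h1]; decide)
  rw [mul_assoc, ht.mul_self, mul_one] at this
  omega

theorem mem_Hplus_iff {M : CoxeterMatrix B} (cs : CoxeterSystem M W) (x y : W)
    (hx : cs.IsReflection x) : y ∈ Hplus cs x ↔ eta cs y⁻¹ x = 0 := by
  have h1 := eta_ne_zero_iff cs y⁻¹ x hx
  have h2 : cs.length (y⁻¹ * x) = cs.length (x * y) := by
    rw [← cs.length_inv, mul_inv_rev, inv_inv, hx.inv]
  rw [h2, cs.length_inv] at h1
  have h3 := hx.length_mul_right_ne y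
  have h4 : y ∈ Hplus cs x ↔ cs.length y < cs.length (x * y) := Iff.rfl
  rw [h4, ← not_iff_not, ← ne_eq (eta cs y⁻¹ x), h1]
  omega

/-- Adjacent chambers lie on the same side of every wall except the one between them. -/
theorem Hplus_adj {M : CoxeterMatrix B} (cs : CoxeterSystem M W) (x y : W) (a : B)
    (hx : cs.IsReflection x) (h : x ≠ y * cs.simple a * y⁻¹) :
    y ∈ Hplus cs x ↔ y * cs.simple a ∈ Hplus cs x := by
  rw [mem_Hplus_iff cs x _ hx, mem_Hplus_iff cs x _ hx, mul_inv_rev, cs.inv_simple, eta_mul,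
    eta_simple, if_neg]
  · simp
  · intro h'
    apply h
    rw [← h']; group

/-- Additivity of length over a minimal coset representative. -/
theorem coset_add {M : CoxeterMatrix B} (cs : CoxeterSystem M W) (P : Set B) (g : W)
    (hmin : ∀ q ∈ Subgroup.closure (cs.simple '' P), cs.length g ≤ cs.length (g * q))
    (ω : List B) (hω : ∀ b ∈ ω, b ∈ P) :
    ∃ ω' : List B, (∀ b ∈ ω', b ∈ P) ∧ cs.wordProd ω' = cs.wordProd ω ∧
      cs.length (g * cs.wordProd ω) = cs.length g + ω'.length := by
  induction ω using List.reverseRecOn with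
  | nil => exact ⟨[], by simp, rfl, by simp⟩
  | append_singleton ω d ih =>
    obtain ⟨ω', h1, h2, h3⟩ := ih (fun b hb => hω b (by simp [hb]))
    have hd : d ∈ P := hω d (by simp)
    rw [cs.wordProd_append, cs.wordProd_singleton]
    rcases cs.length_mul_simple (g * cs.wordProd ω) d with h | h
    · refine ⟨ω' ++ [d], ?_, ?_, ?_⟩
      · intro b hb
        simp at hb
        rcases hb with hb | rfl
        · exact h1 b hb
        · exact hd
      · rw [cs.wordProd_append, cs.wordProd_singleton, h2]
      · rw [← mul_assoc, h, h3]; simp; ring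
    · obtain ⟨γ, hγ, hg⟩ := cs.exists_isReduced g
      have hlt : cs.length (g * cs.wordProd ω * cs.simple d) < cs.length (g * cs.wordProd ω) := by
        omega
      have heta := (eta_ne_zero_iff cs _ _ (cs.isReflection_simple d)).2 hlt
      have hw : g * cs.wordProd ω = cs.wordProd (γ ++ ω') := by
        rw [cs.wordProd_append, ← hg, h2]
      rw [hw, eta_word] at heta
      have hmem : cs.simple d ∈ cs.rightInvSeq (γ ++ ω') := by
        by_contra hn
        rw [List.count_eq_zero_of_not_mem hn] at heta
        simp at heta
      obtain ⟨j, hj, hj2⟩ := List.getElem_of_mem hmem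
      have hdel := cs.wordProd_mul_getD_rightInvSeq (γ ++ ω') j
      rw [List.getD_eq_getElem _ _ hj, hj2] at hdel
      rw [cs.length_rightInvSeq] at hj
      by_cases hjγ : j < γ.length
      · exfalso
        rw [List.eraseIdx_append_of_lt_length hjγ, cs.wordProd_append, cs.wordProd_append, ← hg,
          h2] at hdel
        have hq : cs.wordProd ω ∈ Subgroup.closure (cs.simple '' P) :=
          wordProd_mem_closure cs P ω (fun b hb => hω b (by simp [hb]))
        have := hmin (cs.wordProd ω * cs.simple d * (cs.wordProd ω)⁻¹)
          (mul_mem (mul_mem hq (Subgroup.subset_closure ⟨d, hd, rfl⟩)) (inv_mem hq))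
        rw [← mul_assoc, ← mul_assoc, hdel, mul_inv_cancel_right] at this
        have h5 := cs.length_wordProd_le (γ.eraseIdx j)
        rw [List.length_eraseIdx_of_lt hjγ] at h5
        have h6 : cs.length g = γ.length := by rw [hg]; exact hγ
        omega
      · rw [List.eraseIdx_append_of_length_le (by omega), cs.wordProd_append,
          cs.wordProd_append, ← hg, mul_assoc] at hdel
        have hdel' := mul_left_cancel hdel
        rw [List.length_append] at hj
        refine ⟨ω'.eraseIdx (j - γ.length), ?_, ?_, ?_⟩
        · intro b hb; exact h1 b (List.mem_of_mem_eraseIdx hb)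
        · rw [← hdel', h2]
        · rw [List.length_eraseIdx_of_lt (by omega), ← mul_assoc]
          omega

theorem mem_closure_word {M : CoxeterMatrix B} (cs : CoxeterSystem M W) (P : Set B) (q : W)
    (hq : q ∈ Subgroup.closure (cs.simple '' P)) :
    ∃ ω : List B, (∀ b ∈ ω, b ∈ P) ∧ cs.wordProd ω = q := by
  induction hq using Subgroup.closure_induction with
  | mem x hx =>
    obtain ⟨b, hb, rfl⟩ := hx
    exact ⟨[b], by simpa using hb, by simp⟩
  | one => exact ⟨[], by simp, by simp⟩
  | mul x y _ _ hx hy =>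
    obtain ⟨a, ha, rfl⟩ := hx
    obtain ⟨b, hb, rfl⟩ := hy
    refine ⟨a ++ b, ?_, cs.wordProd_append _ _⟩
    intro c hc
    rcases List.mem_append.1 hc with h | h
    · exact ha c h
    · exact hb c h
  | inv x _ hx =>
    obtain ⟨a, ha, rfl⟩ := hx
    exact ⟨a.reverse, by simpa using ha, cs.wordProd_reverse _⟩

/-- Chambers of a residue lie on the same side of any wall whose reflection does not
stabilise the residue. -/
theorem Hplus_residue {M : CoxeterMatrix B} (cs : CoxeterSystem M W) (x y : W) (P : Set B)
    (hx : cs.IsReflection x) (ω : List B) (hω : ∀ b ∈ ω, b ∈ P)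
    (h : ∀ p ∈ Subgroup.closure (cs.simple '' P), ∀ e ∈ P,
      x ≠ (y * p) * cs.simple e * (y * p)⁻¹) :
    y ∈ Hplus cs x ↔ y * cs.wordProd ω ∈ Hplus cs x := by
  induction ω using List.reverseRecOn with
  | nil => simp
  | append_singleton ω d ih =>
    rw [ih (fun b hb => hω b (by simp [hb])), cs.wordProd_append, cs.wordProd_singleton,
      ← mul_assoc]
    apply Hplus_adj cs x _ d hx
    exact h _ (wordProd_mem_closure cs P ω (fun b hb => hω b (by simp [hb]))) d (hω d (by simp))
/-! ### Chambers incident to a wall lie on one side of a disjoint wall -/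

theorem dih_zpow (β γ : W) (hβ : β * β = 1) (hγ : γ * γ = 1) (k : ℤ) :
    β * (β * γ) ^ k = (β * γ) ^ (-k) * β := by
  have hb : β⁻¹ = β := inv_eq_of_mul_eq_one_left hβ
  have hc : γ⁻¹ = γ := inv_eq_of_mul_eq_one_left hγ
  have h1 : β * (β * γ) * β⁻¹ = (β * γ)⁻¹ := by
    rw [mul_inv_rev, hb, hc, ← mul_assoc, hβ, one_mul]
  have h2 : β * (β * γ) ^ k * β⁻¹ = (β * γ) ^ (-k) := by
    rw [← conj_zpow, h1, inv_zpow, zpow_neg]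
  rw [← h2]; group

theorem dih_elem (β γ : W) (hβ : β * β = 1) (hγ : γ * γ = 1) (p : W)
    (hp : p ∈ Subgroup.closure ({β, γ} : Set W)) :
    ∃ k : ℤ, p = (β * γ) ^ k ∨ p = (β * γ) ^ k * β := by
  have hb : β⁻¹ = β := inv_eq_of_mul_eq_one_left hβ
  have hc : γ⁻¹ = γ := inv_eq_of_mul_eq_one_left hγ
  induction hp using Subgroup.closure_induction with
  | mem x hx =>
    rcases hx with rfl | rfl
    · exact ⟨0, Or.inr (by simp)⟩
    · refine ⟨-1, Or.inr ?_⟩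
      rw [zpow_neg_one, mul_inv_rev, hb, hc, mul_assoc, hβ, mul_one]
  | one => exact ⟨0, Or.inl (by simp)⟩
  | mul x y _ _ hx hy =>
    obtain ⟨k, hx⟩ := hx
    obtain ⟨l, hy⟩ := hy
    rcases hx with rfl | rfl <;> rcases hy with rfl | rfl
    · exact ⟨k + l, Or.inl (by rw [zpow_add])⟩
    · exact ⟨k + l, Or.inr (by rw [zpow_add, mul_assoc])⟩
    · exact ⟨k - l, Or.inr (by
        rw [mul_assoc, dih_zpow β γ hβ hγ, sub_eq_add_neg, zpow_add, mul_assoc])⟩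
    · exact ⟨k - l, Or.inl (by
        rw [mul_assoc, ← mul_assoc β, dih_zpow β γ hβ hγ, mul_assoc _ β, hβ, mul_one,
          sub_eq_add_neg, zpow_add])⟩
  | inv x _ hx =>
    obtain ⟨k, hx⟩ := hx
    rcases hx with rfl | rfl
    · exact ⟨-k, Or.inl (by rw [zpow_neg])⟩
    · refine ⟨k, Or.inr ?_⟩
      rw [mul_inv_rev, hb, ← zpow_neg, dih_zpow β γ hβ hγ, neg_neg]

theorem dih_conj (β γ : W) (hβ : β * β = 1) (hγ : γ * γ = 1) (p : W) (k : ℤ)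
    (hp : p = (β * γ) ^ k ∨ p = (β * γ) ^ k * β) : p * β * p⁻¹ = (β * γ) ^ (2 * k) * β := by
  have h1 : (β * γ) ^ k * β * ((β * γ) ^ k)⁻¹ = (β * γ) ^ (2 * k) * β := by
    rw [← zpow_neg, mul_assoc, dih_zpow β γ hβ hγ, neg_neg, ← mul_assoc, ← zpow_add, two_mul]
  rcases hp with rfl | rfl
  · exact h1
  · rw [← h1]; group

theorem dih_gamma (β γ : W) (hβ : β * β = 1) (hγ : γ * γ = 1) :
    γ = (β * γ) ^ (-1 : ℤ) * β := by
  have hb : β⁻¹ = β := inv_eq_of_mul_eq_one_left hβ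
  have hc : γ⁻¹ = γ := inv_eq_of_mul_eq_one_left hγ
  rw [zpow_neg_one, mul_inv_rev, hb, hc, mul_assoc, hβ, mul_one]

theorem dih_refl (β γ : W) (hβ : β * β = 1) (hγ : γ * γ = 1) (p e : W)
    (hp : p ∈ Subgroup.closure ({β, γ} : Set W)) (he : e = β ∨ e = γ) :
    ∃ j : ℤ, p * e * p⁻¹ = (β * γ) ^ j * β := by
  rcases he with rfl | rfl
  · obtain ⟨k, hk⟩ := dih_elem _ γ hβ hγ p hp
    exact ⟨_, dih_conj _ γ hβ hγ p k hk⟩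
  · have hp' : p * β ∈ Subgroup.closure ({β, e} : Set W) :=
      mul_mem hp (Subgroup.subset_closure (by simp))
    rw [Set.pair_comm] at hp
    obtain ⟨k, hk⟩ := dih_elem e β hγ hβ p hp
    have := dih_conj e β hγ hβ p k hk
    have hb : β⁻¹ = β := inv_eq_of_mul_eq_one_left hβ
    have hc : e⁻¹ = e := inv_eq_of_mul_eq_one_left hγ
    refine ⟨-(2 * k) - 1, ?_⟩
    have h1 : e * β = (β * e)⁻¹ := by rw [mul_inv_rev, hb, hc]
    rw [this, h1, inv_zpow, ← zpow_neg, sub_eq_add_neg, zpow_add, mul_assoc, ← dih_gamma β e hβ hγ]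

theorem dih_fin (β γ : W) (hβ : β * β = 1) (hγ : γ * γ = 1) (p z p' e : W)
    (hp : p ∈ Subgroup.closure ({β, γ} : Set W)) (hp1 : p ≠ 1) (hpβ : p ≠ β)
    (hz : p * β * p⁻¹ = z) (hz' : z = β ∨ z = γ)
    (hp' : p' ∈ Subgroup.closure ({β, γ} : Set W)) (he : e = β ∨ e = γ) :
    ∃ n : ℕ, n ≠ 0 ∧ (p' * e * p'⁻¹ * z) ^ n = 1 := by
  have hN : ∃ N : ℤ, N ≠ 0 ∧ (β * γ) ^ N = 1 := by
    obtain ⟨k, hk⟩ := dih_elem β γ hβ hγ p hp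
    have h1 := dih_conj β γ hβ hγ p k hk
    rw [hz] at h1
    rcases hz' with h2 | h2
    · refine ⟨2 * k, ?_, ?_⟩
      · intro h0
        have : k = 0 := by omega
        subst this
        simp at hk
        tauto
      · rw [h2] at h1
        exact (mul_eq_right.1 h1.symm)
    · refine ⟨2 * k + 1, by omega, ?_⟩
      rw [h2] at h1
      have h3 := (dih_gamma β γ hβ hγ).symm.trans h1
      have h4 := mul_right_cancel h3
      rw [zpow_add, ← h4, ← zpow_add]; simp
  obtain ⟨N, hN0, hN⟩ := hN
  obtain ⟨j, hj⟩ := dih_refl β γ hβ hγ p' e hp' he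
  obtain ⟨i, hi⟩ := dih_refl β γ hβ hγ 1 z (one_mem _) hz'
  have hi' : z = (β * γ) ^ i * β := by simpa using hi
  refine ⟨N.natAbs, by omega, ?_⟩
  have hq : (p' * e * p'⁻¹ * z) = (β * γ) ^ (j - i) := by
    rw [hj, hi', mul_assoc, ← mul_assoc β, dih_zpow β γ hβ hγ, mul_assoc _ β, hβ, mul_one,
      sub_eq_add_neg, zpow_add]
  have hz1 : (p' * e * p'⁻¹ * z) ^ N = 1 := by
    rw [hq, ← zpow_mul, mul_comm, zpow_mul, hN, one_zpow]
  rcases Int.natAbs_eq N with h | h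
  · rw [h, zpow_natCast] at hz1; exact hz1
  · rw [h, zpow_neg, zpow_natCast, inv_eq_one] at hz1; exact hz1

theorem side_aux {M : CoxeterMatrix B} (cs : CoxeterSystem M W) (x u : W)
    (hx : cs.IsReflection x) (hinf : ∀ n : ℕ, n ≠ 0 → (x * u) ^ n ≠ 1) (y : W) (a : B)
    (hy : y⁻¹ * u * y = cs.simple a) (n : ℕ) : ∀ (g : W) (b : B), cs.length g = n →
      g⁻¹ * cs.simple a * g = cs.simple b → (y ∈ Hplus cs x ↔ y * g ∈ Hplus cs x) := by
  have hxu : x ≠ u := by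
    intro h
    apply hinf 2 (by norm_num)
    rw [← h, hx.mul_self, one_pow]
  induction n using Nat.strong_induction_on with
  | _ n IH =>
  intro g b hn hg
  by_cases hg1 : g = 1
  · subst hg1; simp
  obtain ⟨c, hc⟩ := cs.exists_rightDescent_of_ne_one hg1
  by_cases hb : cs.IsRightDescent g b
  · have hlt : cs.length (g * cs.simple b) < n := by rw [← hn]; exact hb
    have h1 := IH _ hlt (g * cs.simple b) b rfl (by
      rw [mul_inv_rev, cs.inv_simple]
      calc cs.simple b * g⁻¹ * cs.simple a * (g * cs.simple b)
          = cs.simple b * (g⁻¹ * cs.simple a * g) * cs.simple b := by group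
        _ = _ := by rw [hg]; simp)
    rw [h1, Hplus_adj cs x (y * (g * cs.simple b)) b hx]
    · simp [mul_assoc]
    · intro h
      apply hxu
      rw [h]
      calc _ = y * g * cs.simple b * (y * g)⁻¹ := by group
        _ = _ := by rw [← hg, ← mul_inv_cancel_right u y, mul_assoc y]
                    have : cs.simple a = y⁻¹ * u * y := hy.symm
                    rw [this]; group
  · have hcb : c ≠ b := by rintro rfl; exact hb hc
    set P : Set B := {b, c} with hP
    set H := Subgroup.closure (cs.simple '' P) with hH
    have hbP : b ∈ P := by simp [hP]
    have hcP : c ∈ P := by simp [hP]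
    have hbH : cs.simple b ∈ H := Subgroup.subset_closure ⟨b, hbP, rfl⟩
    have hcH : cs.simple c ∈ H := Subgroup.subset_closure ⟨c, hcP, rfl⟩
    -- minimal representative
    have hex : ∃ k : ℕ, ∃ q ∈ H, cs.length (g * q) = k := ⟨_, 1, one_mem _, rfl⟩
    obtain ⟨q, hq, hqk⟩ := Nat.find_spec hex
    have hmin0 : ∀ r ∈ H, cs.length (g * q) ≤ cs.length (g * r) := by
      intro r hr
      rw [hqk]
      exact Nat.find_min' hex ⟨r, hr, rfl⟩
    obtain ⟨g1, hg1def⟩ : ∃ g1, g1 = g * q := ⟨_, rfl⟩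
    obtain ⟨p, hpdef⟩ : ∃ p, p = q⁻¹ := ⟨_, rfl⟩
    have hpH : p ∈ H := by rw [hpdef]; exact inv_mem hq
    have hgp : g = g1 * p := by rw [hg1def, hpdef]; group
    have hmin : ∀ r ∈ H, cs.length g1 ≤ cs.length (g1 * r) := by
      intro r hr
      rw [hg1def, mul_assoc]
      exact hmin0 _ (mul_mem hq hr)
    have hp1 : p ≠ 1 := by
      intro h
      rw [h, mul_one] at hgp
      have h1 := hmin _ hcH
      rw [← hgp] at h1
      have h2 : cs.length (g * cs.simple c) < cs.length g := hc
      omega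
    have hpb : p ≠ cs.simple b := by
      intro h
      apply hb
      have h3 : g * cs.simple b = g1 := by rw [hgp, h]; simp [mul_assoc]
      have h1 := hmin _ hpH
      rw [← hgp, ← h3] at h1
      have h2 := cs.length_mul_simple_ne g b
      show cs.length (g * cs.simple b) < cs.length g
      omega
    have hz : g1⁻¹ * cs.simple a * g1 = p * cs.simple b * p⁻¹ := by
      rw [← hg, hgp]; group
    have hzH : p * cs.simple b * p⁻¹ ∈ H := mul_mem (mul_mem hpH hbH) (inv_mem hpH)
    obtain ⟨ζ, hζ, hζz⟩ := mem_closure_word cs P _ hzH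
    obtain ⟨ζ', hζ'P, hζ', hlen⟩ := coset_add cs P g1 hmin ζ hζ
    have hd : ∃ d ∈ P, p * cs.simple b * p⁻¹ = cs.simple d := by
      have h1 : g1 * cs.wordProd ζ = cs.simple a * g1 := by
        rw [hζz, ← hz]; group
      rw [h1] at hlen
      have h2 := cs.length_simple_mul g1 a
      have h3 : ζ'.length ≤ 1 := by omega
      match ζ', h3 with
      | [], _ =>
        exfalso
        rw [hζz, cs.wordProd_nil] at hζ'
        have h5 : cs.simple b = 1 := by
          have : cs.simple b = p⁻¹ * (p * cs.simple b * p⁻¹) * p := by group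
          rw [this, ← hζ']; group
        have := cs.length_simple b
        rw [h5, cs.length_one] at this
        omega
      | [d], _ =>
        refine ⟨d, hζ'P d (by simp), ?_⟩
        rw [← hζz, ← hζ', cs.wordProd_singleton]
    obtain ⟨d, hdP, hd⟩ := hd
    obtain ⟨π, hπ, hπp⟩ := mem_closure_word cs P p hpH
    obtain ⟨π', hπ'P, hπ', hlen'⟩ := coset_add cs P g1 hmin π hπ
    have hlt : cs.length g1 < n := by
      rw [hπp, ← hgp, hn] at hlen'
      have : π' ≠ [] := by
        rintro rfl
        apply hp1
        rw [← hπp, ← hπ', cs.wordProd_nil]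
      have := List.length_pos_iff.2 this
      omega
    have h1 := IH _ hlt g1 d rfl (by rw [hz, hd])
    rw [h1, hgp, ← mul_assoc, ← hπp]
    apply Hplus_residue cs x (y * g1) P hx π hπ
    intro p' hp' e he hxe
    have himg : cs.simple '' P = {cs.simple b, cs.simple c} := by
      rw [hP, Set.image_pair]
    rw [hH, himg] at hpH
    rw [himg] at hp'
    have he' : cs.simple e = cs.simple b ∨ cs.simple e = cs.simple c := by
      rcases he with rfl | rfl <;> simp
    have hd' : cs.simple d = cs.simple b ∨ cs.simple d = cs.simple c := by
      rcases hdP with rfl | rfl <;> simp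
    obtain ⟨N, hN0, hN⟩ := dih_fin (cs.simple b) (cs.simple c) (by simp) (by simp) p (cs.simple d)
      p' (cs.simple e) hpH hp1 hpb hd hd' hp' he'
    apply hinf N hN0
    have hu : u = (y * g1) * cs.simple d * (y * g1)⁻¹ := by
      rw [← hd, ← hz, ← hy]; group
    have hprod : x * u = (y * g1) * (p' * cs.simple e * p'⁻¹ * cs.simple d) * (y * g1)⁻¹ := by
      rw [hxe, hu]; group
    rw [hprod, conj_pow, hN]; group

theorem side_lemma {M : CoxeterMatrix B} (cs : CoxeterSystem M W) (x u : W)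
    (hx : cs.IsReflection x) (hinf : ∀ n : ℕ, n ≠ 0 → (x * u) ^ n ≠ 1) (y y' : W)
    (hy : y ∈ IncidentWall cs u) (hy' : y' ∈ IncidentWall cs u) :
    y ∈ Hplus cs x ↔ y' ∈ Hplus cs x := by
  obtain ⟨a, ha⟩ := hy
  obtain ⟨b, hb⟩ := hy'
  have := side_aux cs x u hx hinf y a ha _ (y⁻¹ * y') b rfl (by
    rw [← ha, ← hb]; group)
  rwa [mul_inv_cancel_left] at this

theorem side_sub {M : CoxeterMatrix B} (cs : CoxeterSystem M W) (x u : W)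
    (hx : cs.IsReflection x) (hinf : ∀ n : ℕ, n ≠ 0 → (x * u) ^ n ≠ 1) (y : W)
    (hy : y ∈ IncidentWall cs u) : IncidentWall cs u ⊆ Hplus cs x ↔ y ∈ Hplus cs x :=
  ⟨fun h => h hy, fun h y' hy' => (side_lemma cs x u hx hinf y y' hy hy').1 h⟩
/-! ### The moves -/

/-- A combinatorial marking. -/
def Mark (M : CoxeterMatrix B) (s : B) (ω : List B) (m : B) : Prop :=
  Good M s ω ∧ Clq M (supp s ω) ∧ ∃ e ∈ supp s ω, M e m = 0

theorem Mark.notMem {M : CoxeterMatrix B} {s : B} {ω : List B} {m : B} (h : Mark M s ω m) :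
    m ∉ supp s ω := by
  intro hm
  obtain ⟨_, hc, e, he, h0⟩ := h
  by_cases hem : e = m
  · subst hem; rw [M.diagonal] at h0; omega
  · exact hc e he m hm hem h0

/-- The half-space of a marking contains the identity chamber. -/
def Phi {M : CoxeterMatrix B} {M' : CoxeterMatrix B'} (cs : CoxeterSystem M W)
    (cs' : CoxeterSystem M' W) (s : B) (ω : List B) (m : B) : Prop :=
  IncidentWall cs' ((cs.wordProd ω) * cs.simple m * (cs.wordProd ω)⁻¹) ⊆
        Hplus cs' (cs.simple s)

/-- Angle-compatibility. -/
def AngleC {M : CoxeterMatrix B} {M' : CoxeterMatrix B'} (cs : CoxeterSystem M W)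
    (cs' : CoxeterSystem M' W) : Prop :=
  ∀ a b : B, a ≠ b → M a b ≠ 0 → ∃ (w : W) (i j : B'),
    w * cs.simple a * w⁻¹ = cs'.simple i ∧ w * cs.simple b * w⁻¹ = cs'.simple j

theorem phi_M1 {M : CoxeterMatrix B} {M' : CoxeterMatrix B'} (cs : CoxeterSystem M W)
    (cs' : CoxeterSystem M' W) (hang : AngleC cs cs') (s : B)
    (hx : cs'.IsReflection (cs.simple s)) (ω : List B) (m m' : B) (h : Mark M s ω m)
    (h' : Mark M s ω m') (hne : m ≠ m') (hadj : M m m' ≠ 0) :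
    Phi cs cs' s ω m ↔ Phi cs cs' s ω m' := by
  obtain ⟨w, i, j, hi, hj⟩ := hang m m' hne hadj
  have hn := h.notMem
  have hn' := h'.notMem
  obtain ⟨hg, _, e, he, he0⟩ := h
  obtain ⟨_, _, e', he', he0'⟩ := h'
  unfold Phi
  rw [side_sub cs' _ _ hx (fun n hn0 => infinite_of_zero cs s ω hg m e hn he he0 n hn0)
      (cs.wordProd ω * w⁻¹) ⟨i, by rw [← hi]; group⟩,
    side_sub cs' _ _ hx (fun n hn0 => infinite_of_zero cs s ω hg m' e' hn' he' he0' n hn0)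
      (cs.wordProd ω * w⁻¹) ⟨j, by rw [← hj]; group⟩]

theorem phi_M2 {M : CoxeterMatrix B} {M' : CoxeterMatrix B'} (cs : CoxeterSystem M W)
    (cs' : CoxeterSystem M' W) (hang : AngleC cs cs') (s : B)
    (hx : cs'.IsReflection (cs.simple s)) (ω : List B) (m l : B) (h : Mark M s ω m)
    (hgl : Good M s (ω ++ [l])) (hne : l ≠ m) (hadj : M l m ≠ 0) :
    Phi cs cs' s ω m ↔ Phi cs cs' s (ω ++ [l]) m := by
  obtain ⟨w, j, i, hj, hi⟩ := hang l m hne hadj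
  have hn := h.notMem
  obtain ⟨hg, _, e, he, he0⟩ := h
  have hinf := fun n hn0 => infinite_of_zero cs s ω hg m e hn he he0 n hn0
  have hsl := supp_snoc s ω l
  have hinf' := fun n hn0 => infinite_of_zero cs s (ω ++ [l]) hgl m e
    (by rw [hsl]; rintro (h | h); exacts [hne h.symm, hn h]) (by rw [hsl]; exact Or.inr he)
    he0 n hn0
  have hv : (cs.wordProd ω * w⁻¹) * cs'.simple j = cs.wordProd (ω ++ [l]) * w⁻¹ := by
    rw [cs.wordProd_append, cs.wordProd_singleton, ← hj]; group
  unfold Phi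
  rw [side_sub cs' _ _ hx hinf (cs.wordProd ω * w⁻¹) ⟨i, by rw [← hi]; group⟩,
    side_sub cs' _ _ hx hinf' (cs.wordProd (ω ++ [l]) * w⁻¹) ⟨i, by rw [← hi]; group⟩, ← hv]
  apply Hplus_adj cs' _ _ _ hx
  intro hxe
  apply hinf (M l m) hadj
  have : cs.simple s * (cs.wordProd ω * cs.simple m * (cs.wordProd ω)⁻¹) =
      cs.wordProd ω * (cs.simple l * cs.simple m) * (cs.wordProd ω)⁻¹ := by
    rw [hxe, ← hj]; group
  rw [this, conj_pow, cs.simple_mul_simple_pow]; group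

/-- The abstract properties of the half-space predicate used in the combinatorial argument. -/
structure PhiProp (M : CoxeterMatrix B) (s : B) (Φ : List B → B → Prop) : Prop where
  perm : ∀ ω ω' m, Good M s ω → Good M s ω' → supp s ω = supp s ω' → Clq M (supp s ω) →
    (Φ ω m ↔ Φ ω' m)
  m1 : ∀ ω m m', Mark M s ω m → Mark M s ω m' → m ≠ m' → M m m' ≠ 0 → (Φ ω m ↔ Φ ω m')
  m2 : ∀ ω m l, Mark M s ω m → Good M s (ω ++ [l]) → l ≠ m → M l m ≠ 0 →
    (Φ ω m ↔ Φ (ω ++ [l]) m)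

theorem phiProp {M : CoxeterMatrix B} {M' : CoxeterMatrix B'} (cs : CoxeterSystem M W)
    (cs' : CoxeterSystem M' W) (hFC : IsFC cs) (hang : AngleC cs cs') (s : B)
    (hx : cs'.IsReflection (cs.simple s)) : PhiProp M s (Phi cs cs' s) where
  perm ω ω' m h h' he hc := by
    unfold Phi; rw [good_unique cs hFC s ω h ω' h' he hc]
  m1 := phi_M1 cs cs' hang s hx
  m2 := phi_M2 cs cs' hang s hx

/-! ### Simple markings are combinatorial markings -/

theorem mark_of_simple {M : CoxeterMatrix B} (cs : CoxeterSystem M W) (hFC : IsFC cs)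
    (s : B) (ω : List B) (m : B) (h : IsSimpleMarking cs s ω m) : Mark M s ω m := by
  obtain ⟨hnd, hs, hdist, -, hsph, hnsph⟩ := h
  have hclq : Clq M (supp s ω) := clq_of_spherical cs _ hsph
  refine ⟨?_, hclq, ?_⟩
  · have := (good_append_iff M s [] ω).2 ⟨Good.nil, ?_⟩
    · simpa using this
    intro α l β hω
    subst hω
    simp only [List.nil_append]
    have hlα : l ∉ α := by
      rw [List.nodup_append] at hnd
      intro hl
      exact hnd.2.2 l hl l (by simp) rfl
    have hls : l ≠ s := by rintro rfl; apply hs; simp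
    have hlsupp : l ∉ supp s α := by
      rintro (h | h)
      · exact hls h
      · exact hlα h
    refine ⟨hlsupp, ?_⟩
    by_contra hcon
    push Not at hcon
    have hcomm := wordProd_comm cs l α (fun b hb => hcon b (Or.inr hb))
    have hcs := simple_comm cs s l (hcon s (core_mem_supp _ _))
    have h1 := hdist (cs.simple l) ⟨s, by
      rw [cs.inv_simple, ← hcs]; simp⟩
    have h2 : (cs.wordProd (α ++ l :: β))⁻¹ * cs.simple l = (cs.wordProd (α ++ β))⁻¹ := by
      rw [cs.wordProd_append, cs.wordProd_cons, cs.wordProd_append, ← mul_assoc, ← hcomm]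
      simp only [mul_inv_rev, cs.inv_simple, mul_assoc, cs.simple_mul_simple_self, mul_one]
    rw [h2, cs.length_inv] at h1
    have h3 := cs.length_wordProd_le (α ++ β)
    simp at h1 h3
    omega
  · by_contra hcon
    push Not at hcon
    apply hnsph
    apply hFC
    intro a ha b hb hab
    rcases ha with rfl | ha <;> rcases hb with rfl | hb
    · exact absurd rfl hab
    · rw [M.symmetric]; exact hcon b hb
    · exact hcon a ha
    · exact hclq a ha b hb hab
/-! ### Combinatorics of markings -/

/-- All markings whose support contains `J` have the same half-space. -/
def HH (M : CoxeterMatrix B) (s : B) (Φ : List B → B → Prop) (J : Set B) : Prop :=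
  ∀ ω m ω' m', Mark M s ω m → Mark M s ω' m' → J ⊆ supp s ω → J ⊆ supp s ω' →
    (Φ ω m ↔ Φ ω' m')

/-- The marking `(ω, m)` is attached to the node `a`. -/
def Att (s : B) (ω0 : List B) (a : B) (ω : List B) (m : B) : Prop :=
  (ω = ω0 ∧ m = a) ∨ insert a (supp s ω0) ⊆ supp s ω

theorem good_ext {M : CoxeterMatrix B} {s : B} {ω0 : List B} (hg : Good M s ω0) {l : B}
    (hl : l ∉ supp s ω0 ∪ perpIdx M (supp s ω0)) : Good M s (ω0 ++ [l]) := by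
  rw [good_snoc_iff]
  have h1 : l ∉ supp s ω0 := fun h => hl (Or.inl h)
  refine ⟨hg, h1, ?_⟩
  by_contra hcon
  push Not at hcon
  exact hl (Or.inr ⟨h1, fun k hk => by rw [M.symmetric]; exact hcon k hk⟩)

theorem clq_insert {M : CoxeterMatrix B} {J : Set B} {l : B} (hc : Clq M J)
    (h : ∀ e ∈ J, M e l ≠ 0) : Clq M (insert l J) := by
  intro a ha b hb hab
  rcases ha with rfl | ha <;> rcases hb with rfl | hb
  · exact absurd rfl hab
  · rw [M.symmetric]; exact h b hb
  · exact h a ha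
  · exact hc a ha b hb hab

theorem adj_of_clq {M : CoxeterMatrix B} {J K : Set B} {l : B} (hc : Clq M K)
    (h : insert l J ⊆ K) (hl : l ∉ J) : ∀ e ∈ J, M e l ≠ 0 := by
  intro e he
  apply hc e (h (Or.inr he)) l (h (Or.inl rfl))
  rintro rfl
  exact hl he

/-- The inductive hypothesis on extensions. -/
def ExtH (M : CoxeterMatrix B) (s : B) (Φ : List B → B → Prop) (ω0 : List B) : Prop :=
  ∀ l, l ∉ supp s ω0 ∪ perpIdx M (supp s ω0) → (∀ e ∈ supp s ω0, M e l ≠ 0) →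
    HH M s Φ (insert l (supp s ω0))

theorem node_same {M : CoxeterMatrix B} {s : B} {Φ : List B → B → Prop} {ω0 : List B}
    (hH : ExtH M s Φ ω0) {a : B} (ha : a ∉ supp s ω0 ∪ perpIdx M (supp s ω0))
    {ω : List B} {m : B} {ω' : List B} {m' : B}
    (h : Mark M s ω m) (h' : Mark M s ω' m') (hA : Att s ω0 a ω m) (hA' : Att s ω0 a ω' m') :
    Φ ω m ↔ Φ ω' m' := by
  have ha1 : a ∉ supp s ω0 := fun h => ha (Or.inl h)
  rcases hA with ⟨rfl, rfl⟩ | hA <;> rcases hA' with ⟨rfl, rfl⟩ | hA'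
  · rfl
  · obtain ⟨_, _, e, he, h0⟩ := h
    exact absurd h0 (adj_of_clq h'.2.1 hA' ha1 e he)
  · obtain ⟨_, _, e, he, h0⟩ := h'
    exact absurd h0 (adj_of_clq h.2.1 hA ha1 e he)
  · exact hH a ha (adj_of_clq h.2.1 hA ha1) _ _ _ _ h h' hA hA'

theorem edge_step {M : CoxeterMatrix B} {s : B} {Φ : List B → B → Prop} (hΦ : PhiProp M s Φ)
    {ω0 : List B} (hg : Good M s ω0) (hc : Clq M (supp s ω0))
    (hH : ExtH M s Φ ω0) {a a' : B} (ha : a ∉ supp s ω0 ∪ perpIdx M (supp s ω0))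
    (ha' : a' ∉ supp s ω0 ∪ perpIdx M (supp s ω0)) (hne : a ≠ a') (hadj : M a a' ≠ 0)
    {ω : List B} {m : B} (h : Mark M s ω m) (hA : Att s ω0 a ω m) :
    ∃ ω' m', Mark M s ω' m' ∧ Att s ω0 a' ω' m' ∧ (Φ ω m ↔ Φ ω' m') := by
  have ha1 : a ∉ supp s ω0 := fun h => ha (Or.inl h)
  have ha1' : a' ∉ supp s ω0 := fun h => ha' (Or.inl h)
  have hga := good_ext hg ha
  have hga' := good_ext hg ha'
  rcases hA with ⟨rfl, rfl⟩ | hA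
  · by_cases hn : ∃ e ∈ supp s ω, M e a' = 0
    · have h' : Mark M s ω a' := ⟨hg, hc, hn⟩
      exact ⟨ω, a', h', Or.inl ⟨rfl, rfl⟩, hΦ.m1 ω m a' h h' hne hadj⟩
    · push Not at hn
      refine ⟨ω ++ [a'], m, ⟨hga', ?_, ?_⟩, Or.inr ?_, hΦ.m2 ω m a' h hga' hne.symm ?_⟩
      · rw [supp_snoc]; exact clq_insert hc hn
      · obtain ⟨_, _, e, he, h0⟩ := h
        exact ⟨e, by rw [supp_snoc]; exact Or.inr he, h0⟩
      · rw [supp_snoc]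
      · rw [M.symmetric]; exact hadj
  · have haa := adj_of_clq h.2.1 hA ha1
    have hHa := hH a ha haa
    have hca : Clq M (supp s (ω0 ++ [a])) := by rw [supp_snoc]; exact clq_insert hc haa
    by_cases hn : ∃ e ∈ supp s ω0, M e a' = 0
    · have h' : Mark M s ω0 a' := ⟨hg, hc, hn⟩
      have h'' : Mark M s (ω0 ++ [a]) a' := by
        refine ⟨hga, hca, ?_⟩
        obtain ⟨e, he, h0⟩ := hn
        exact ⟨e, by rw [supp_snoc]; exact Or.inr he, h0⟩
      refine ⟨ω0, a', h', Or.inl ⟨rfl, rfl⟩, ?_⟩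
      rw [hΦ.m2 ω0 a' a h' hga hne hadj]
      exact hHa _ _ _ _ h h'' hA (by rw [supp_snoc])
    · push Not at hn
      obtain ⟨k, hk, hk2⟩ := ((good_snoc_iff M s ω0 a').1 hga').2.2
      have hgQ : Good M s (ω0 ++ [a] ++ [a']) := by
        rw [good_snoc_iff M s (ω0 ++ [a]) a']
        rw [supp_snoc]
        refine ⟨hga, ?_, k, Or.inr hk, hk2⟩
        rintro (h | h)
        · exact hne h.symm
        · exact ha1' h
      have hsQ : supp s (ω0 ++ [a] ++ [a']) = insert a' (insert a (supp s ω0)) := by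
        rw [supp_snoc, supp_snoc]
      have hcQ : Clq M (supp s (ω0 ++ [a] ++ [a'])) := by
        rw [supp_snoc]
        apply clq_insert hca
        rw [supp_snoc]
        rintro e (rfl | he)
        · exact hadj
        · exact hn e he
      by_cases hp : ∃ p, Mark M s (ω0 ++ [a] ++ [a']) p
      · obtain ⟨p, hp⟩ := hp
        refine ⟨_, p, hp, Or.inr ?_, hHa _ _ _ _ h hp hA ?_⟩
        · rw [hsQ]
          exact Set.insert_subset_insert (Set.subset_insert _ _)
        · rw [hsQ]
          exact Set.subset_insert _ _
      · have hall : ∀ p, M a' p ≠ 0 := by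
          intro p h0
          exact hp ⟨p, hgQ, hcQ, a', by rw [hsQ]; exact Or.inl rfl, h0⟩
        have hJ : supp s ω0 ⊆ supp s ω := fun x hx => hA (Or.inr hx)
        by_cases hmem : a' ∈ supp s ω
        · refine ⟨ω, m, h, Or.inr ?_, Iff.rfl⟩
          rintro x (rfl | hx)
          · exact hmem
          · exact hJ hx
        · have h' : Mark M s (ω ++ [a']) m := by
            refine ⟨(good_snoc_iff _ _ _ _).2 ⟨h.1, hmem, k, hJ hk, hk2⟩, ?_, ?_⟩
            · rw [supp_snoc]
              apply clq_insert h.2.1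
              intro e _
              rw [M.symmetric]; exact hall e
            · obtain ⟨_, _, e, he, h0⟩ := h
              exact ⟨e, by rw [supp_snoc]; exact Or.inr he, h0⟩
          refine ⟨_, m, h', Or.inr ?_, hHa _ _ _ _ h h' hA ?_⟩
          · rw [supp_snoc]; exact Set.insert_subset_insert hJ
          · rw [supp_snoc]; exact hA.trans (Set.subset_insert _ _)

theorem path_step {M : CoxeterMatrix B} {s : B} {Φ : List B → B → Prop} (hΦ : PhiProp M s Φ)
    {ω0 : List B} (hg : Good M s ω0) (hc : Clq M (supp s ω0))
    (hH : ExtH M s Φ ω0) {a a' : B} 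
    (hp : Relation.ReflTransGen (fun x y => x ∉ supp s ω0 ∪ perpIdx M (supp s ω0) ∧
      y ∉ supp s ω0 ∪ perpIdx M (supp s ω0) ∧ x ≠ y ∧ M x y ≠ 0) a a')
    {ω : List B} {m : B} (h : Mark M s ω m) (hA : Att s ω0 a ω m) :
    ∃ ω' m', Mark M s ω' m' ∧ Att s ω0 a' ω' m' ∧ (Φ ω m ↔ Φ ω' m') := by
  induction hp with
  | refl => exact ⟨ω, m, h, hA, Iff.rfl⟩
  | tail _ hst ih =>
    obtain ⟨ω', m', h1, h2, h3⟩ := ih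
    obtain ⟨ω'', m'', h4, h5, h6⟩ := edge_step hΦ hg hc hH hst.1 hst.2.1 hst.2.2.1 hst.2.2.2 h1 h2
    exact ⟨ω'', m'', h4, h5, h3.trans h6⟩

theorem exists_letter {M : CoxeterMatrix B} {s : B} {ω : List B} (h : Good M s ω) (J : Set B)
    (hs : s ∈ J) (hn : ¬ supp s ω ⊆ J) : ∃ l ∈ supp s ω, l ∉ J ∧ ∃ k ∈ J, M k l ≠ 2 := by
  induction h with
  | nil =>
    exfalso; apply hn
    rintro x (rfl | hx)
    · exact hs
    · simp at hx
  | snoc ω l h1 h2 h3 ih =>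
    by_cases hsub : supp s ω ⊆ J
    · obtain ⟨e, he, he2⟩ := h3
      refine ⟨l, by rw [supp_snoc]; exact Or.inl rfl, ?_, e, hsub he, he2⟩
      intro hl
      apply hn
      rw [supp_snoc]
      exact Set.insert_subset hl hsub
    · obtain ⟨l', hl', h4⟩ := ih hsub
      exact ⟨l', by rw [supp_snoc]; exact Or.inr hl', h4⟩

theorem node_exists {M : CoxeterMatrix B} {s : B} {Φ : List B → B → Prop} (hΦ : PhiProp M s Φ)
    {ω0 : List B} (hg : Good M s ω0) {ω : List B} {m : B} (h : Mark M s ω m)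
    (hJ : supp s ω0 ⊆ supp s ω) :
    ∃ a, a ∉ supp s ω0 ∪ perpIdx M (supp s ω0) ∧
      ((supp s ω = supp s ω0 ∧ a = m) ∨ (supp s ω ≠ supp s ω0 ∧ a ∈ supp s ω)) ∧
      ∃ ω' m', Mark M s ω' m' ∧ Att s ω0 a ω' m' ∧ (Φ ω m ↔ Φ ω' m') := by
  by_cases he : supp s ω = supp s ω0
  · refine ⟨m, ?_, Or.inl ⟨he, rfl⟩, ω0, m, ⟨hg, he ▸ h.2.1, he ▸ h.2.2⟩, Or.inl ⟨rfl, rfl⟩,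
      hΦ.perm _ _ _ h.1 hg he h.2.1⟩
    have hn := h.notMem
    obtain ⟨_, _, e, hes, h0⟩ := h
    rintro (h1 | h1)
    · exact hn (he ▸ h1)
    · have := h1.2 e (he ▸ hes)
      rw [M.symmetric] at this
      omega
  · have hn : ¬ supp s ω ⊆ supp s ω0 := fun h1 => he (h1.antisymm hJ)
    obtain ⟨l, hl, hlJ, k, hk, hk2⟩ := exists_letter h.1 _ (core_mem_supp s ω0) hn
    refine ⟨l, ?_, Or.inr ⟨he, hl⟩, ω, m, h, Or.inr (Set.insert_subset hl hJ), Iff.rfl⟩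
    rintro (h1 | h1)
    · exact hlJ h1
    · have := h1.2 k hk
      rw [M.symmetric] at this
      exact hk2 this

theorem path_conclude {M : CoxeterMatrix B} {s : B} {Φ : List B → B → Prop} (hΦ : PhiProp M s Φ)
    {ω0 : List B} (hg : Good M s ω0) (hc : Clq M (supp s ω0))
    (hH : ExtH M s Φ ω0) {a a' : B} (ha' : a' ∉ supp s ω0 ∪ perpIdx M (supp s ω0))
    (hp : Relation.ReflTransGen (fun x y => x ∉ supp s ω0 ∪ perpIdx M (supp s ω0) ∧
      y ∉ supp s ω0 ∪ perpIdx M (supp s ω0) ∧ x ≠ y ∧ M x y ≠ 0) a a')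
    {ω : List B} {m : B} (h : Mark M s ω m) (hA : Att s ω0 a ω m)
    {ω' : List B} {m' : B} (h' : Mark M s ω' m') (hA' : Att s ω0 a' ω' m') :
    Φ ω m ↔ Φ ω' m' := by
  obtain ⟨ω'', m'', h1, h2, h3⟩ := path_step hΦ hg hc hH hp h hA
  exact h3.trans (node_same hH ha' h1 h' h2 hA')

theorem good_irred_aux {M : CoxeterMatrix B} {s : B} {ω : List B} (h : Good M s ω) (K : Set B)
    (hK : supp s ω ⊆ K ∪ perpIdx M K) :
    (s ∈ K → supp s ω ⊆ K) ∧ (s ∉ K → ∀ b ∈ supp s ω, b ∉ K) := by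
  induction h with
  | nil =>
    constructor
    · rintro hs x (rfl | hx)
      · exact hs
      · simp at hx
    · rintro hs x (rfl | hx)
      · exact hs
      · simp at hx
  | snoc ω l h1 h2 h3 ih =>
    rw [supp_snoc] at hK ⊢
    obtain ⟨ih1, ih2⟩ := ih (fun x hx => hK (Or.inr hx))
    obtain ⟨e, he, he2⟩ := h3
    constructor
    · intro hs
      refine Set.insert_subset ?_ (ih1 hs)
      rcases hK (Or.inl rfl : l ∈ insert l (supp s ω)) with h | h
      · exact h
      · exact absurd (h.2 e (ih1 hs he)) (by rw [M.symmetric]; exact he2)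
    · rintro hs b (rfl | hb)
      · intro hbK
        rcases hK (Or.inr he) with h | h
        · exact ih2 hs e he h
        · exact he2 (h.2 b hbK)
      · exact ih2 hs b hb

theorem good_irred {M : CoxeterMatrix B} {s : B} {ω : List B} (h : Good M s ω) :
    IrredIdx M (supp s ω) := by
  intro K hK hne hsub
  obtain ⟨h1, h2⟩ := good_irred_aux h K hsub
  by_cases hs : s ∈ K
  · exact hK.2 (h1 hs)
  · obtain ⟨x, hx⟩ := hne
    exact h2 hs x (hK.1 hx) hx

theorem good_ncard {M : CoxeterMatrix B} {s : B} {ω : List B} (h : Good M s ω) :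
    (supp s ω).ncard = ω.length + 1 := by
  obtain ⟨h1, h2⟩ := good_nodup M s ω h
  have h3 : ({b | b ∈ ω} : Set B) = ↑(ω.toFinset) := by ext; simp
  unfold supp
  rw [h3, Set.ncard_insert_of_notMem (by simpa using h2), Set.ncard_coe_finset,
    List.toFinset_card_of_nodup h1]

theorem good_finite (s : B) (ω : List B) : (supp s ω).Finite := by
  have h3 : ({b | b ∈ ω} : Set B) = ↑(ω.toFinset) := by ext; simp
  unfold supp
  rw [h3]
  exact (Finset.finite_toSet _).insert s

/-- Extension of good cliques. -/
def ExtR (M : CoxeterMatrix B) (s : B) (ω' ω : List B) : Prop :=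
  Good M s ω' ∧ Clq M (supp s ω') ∧ ∃ l, ω' = ω ++ [l]

theorem extR_wf {M : CoxeterMatrix B} (cs : CoxeterSystem M W) (hFC : IsFC cs) (s : B) :
    WellFounded (ExtR M s) := by
  rw [wellFounded_iff_isEmpty_descending_chain]
  constructor
  rintro ⟨x, hx⟩
  have hmono : Monotone (fun n => supp s (x n)) := by
    apply monotone_nat_of_le_succ
    intro n
    obtain ⟨_, _, l, hl⟩ := hx n
    rw [hl, supp_snoc]
    exact Set.subset_insert _ _
  have hclq : Clq M (⋃ n, supp s (x n)) := by
    intro a ha b hb hab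
    obtain ⟨i, hi⟩ := Set.mem_iUnion.1 ha
    obtain ⟨j, hj⟩ := Set.mem_iUnion.1 hb
    have h1 : i ≤ max i j + 1 := by omega
    have h2 : j ≤ max i j + 1 := by omega
    exact (hx (max i j)).2.1 a (hmono h1 hi) b (hmono h2 hj) hab
  have hsph := hFC _ hclq
  have hfin : (⋃ n, supp s (x n)).Finite := by
    have h1 : (cs.simple '' (⋃ n, supp s (x n))).Finite :=
      Set.Finite.subset hsph Subgroup.subset_closure
    exact h1.of_finite_image (gsimple_injective cs).injOn
  have hlen : ∀ n, n ≤ (x n).length := by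
    intro n
    induction n with
    | zero => omega
    | succ n ih =>
      obtain ⟨_, _, l, hl⟩ := hx n
      rw [hl]; simp; omega
  set N := (⋃ n, supp s (x n)).ncard with hN
  have h1 := good_ncard (hx N).1
  have h2 := Set.ncard_le_ncard (Set.subset_iUnion (fun n => supp s (x n)) (N + 1)) hfin
  have h3 := hlen (N + 1)
  omega

theorem HH_main {M : CoxeterMatrix B} (cs : CoxeterSystem M W) (hFC : IsFC cs)
    (hrig : ThreeRigidIdx M) (s : B) {Φ : List B → B → Prop} (hΦ : PhiProp M s Φ)
    (ω0 : List B) : Good M s ω0 → Clq M (supp s ω0) → 2 ≤ ω0.length →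
      HH M s Φ (supp s ω0) := by
  induction ω0 using (extR_wf cs hFC s).induction with
  | _ ω0 IH =>
  intro hg hc hlen
  have hH : ExtH M s Φ ω0 := by
    intro l hl hadj
    have h1 := good_ext hg hl
    have h2 : Clq M (supp s (ω0 ++ [l])) := by rw [supp_snoc]; exact clq_insert hc hadj
    have := IH (ω0 ++ [l]) ⟨h1, h2, l, rfl⟩ h1 h2 (by simp; omega)
    rwa [supp_snoc] at this
  intro ω m ω' m' h h' hJ hJ'
  obtain ⟨a, ha, -, ω₁, m₁, h1, h2, h3⟩ := node_exists hΦ hg h hJ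
  obtain ⟨a', ha', -, ω₂, m₂, h1', h2', h3'⟩ := node_exists hΦ hg h' hJ'
  have hsc := hrig _ hc (good_irred hg) (by rw [good_ncard hg]; omega) a a' ha ha'
  rw [h3, h3']
  exact path_conclude hΦ hg hc hH ha' hsc.2.2 h1 h2 h1' h2'

theorem extH_of_long {M : CoxeterMatrix B} (cs : CoxeterSystem M W) (hFC : IsFC cs)
    (hrig : ThreeRigidIdx M) (s : B) {Φ : List B → B → Prop} (hΦ : PhiProp M s Φ)
    (ω0 : List B) (hg : Good M s ω0) (hc : Clq M (supp s ω0)) (hlen : 1 ≤ ω0.length) :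
    ExtH M s Φ ω0 := by
  intro l hl hadj
  have h1 := good_ext hg hl
  have h2 : Clq M (supp s (ω0 ++ [l])) := by rw [supp_snoc]; exact clq_insert hc hadj
  have := HH_main cs hFC hrig s hΦ (ω0 ++ [l]) h1 h2 (by simp; omega)
  rwa [supp_snoc] at this

theorem node_in_comp {M : CoxeterMatrix B} {s t : B} {ω : List B} {m a : B} {A : Set B}
    (hst : supp s [t] = {s, t})
    (hK : Kst M s t ω m ⊆ A) (ha : a ∉ supp s [t] ∪ perpIdx M (supp s [t]))
    (h : (supp s ω = supp s [t] ∧ a = m) ∨ (supp s ω ≠ supp s [t] ∧ a ∈ supp s ω)) : a ∈ A := by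
  apply hK
  rw [hst] at h ha
  unfold Kst
  rcases h with ⟨h1, rfl⟩ | ⟨h1, h2⟩
  · have h1' : (insert s {b | b ∈ ω} : Set B) = {s, t} := h1
    rw [if_pos h1']
    rfl
  · have h1' : (insert s {b | b ∈ ω} : Set B) ≠ {s, t} := h1
    rw [if_neg h1']
    exact ⟨h2, ha⟩

theorem path_symm {M : CoxeterMatrix B} {X : Set B} {a b : B}
    (h : Relation.ReflTransGen (fun x y => x ∉ X ∧ y ∉ X ∧ x ≠ y ∧ M x y ≠ 0) a b) :
    Relation.ReflTransGen (fun x y => x ∉ X ∧ y ∉ X ∧ x ≠ y ∧ M x y ≠ 0) b a := by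
  induction h with
  | refl => exact Relation.ReflTransGen.refl
  | tail _ hxy ih =>
    obtain ⟨hx1, hx2, hx3, hx4⟩ := hxy
    exact Relation.ReflTransGen.trans
      (Relation.ReflTransGen.single ⟨hx2, hx1, hx3.symm, by rw [M.symmetric]; exact hx4⟩) ih

/-- Let `S` be a 3-rigid Coxeter generating set of type FC of `W` (the system `cs`),
angle-compatible with a Coxeter generating set `S'` (the system `cs'`, whose Davis
complex is the ambient complex), and let `{s,t} ⊆ S` be irreducible spherical.  For
any component `A` of `S ∖ ({s,t} ∪ {s,t}^⊥)` and any two simple markings `μ = ((s,ω₁),m₁)`,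
`μ' = ((s,ω₂),m₂)` with supports containing `t`, core `s`, and
`K^μ_{s,t}, K^{μ'}_{s,t} ⊆ A`, the associated halfspaces of the wall `𝒲_s` in the
ambient complex satisfy `Φ^μ_s = Φ^{μ'}_s`: the chambers incident to the wall
`ω₁·𝒲_{m₁}` lie in the halfspace of `𝒲_s` containing the identity chamber if and only
if the chambers incident to `ω₂·𝒲_{m₂}` do.  Thus `Φ^{t,A}_s` depends only on `s`, `t`
and the component `A`. -/
theorem halfspace_depends_only_on_component
    (M : CoxeterMatrix B) (cs : CoxeterSystem M W)
    (M' : CoxeterMatrix B') (cs' : CoxeterSystem M' W)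
    (hFC : IsFC cs) (hrig : ThreeRigidIdx M)
    -- angle-compatibility of `S` with `S'`
    (hangle : ∀ a b : B, a ≠ b → M a b ≠ 0 → ∃ (w : W) (a' b' : B'),
      ({w * cs.simple a * w⁻¹, w * cs.simple b * w⁻¹} : Set W) =
        {cs'.simple a', cs'.simple b'})
    -- `{s,t}` is irreducible spherical
    (s t : B) (hst : s ≠ t) (hadj : M s t ≠ 0) (hncomm : M s t ≠ 2)
    -- `A` is a component of `S ∖ ({s,t} ∪ {s,t}^⊥)`
    (A : Set B) (hA : IsCompIdx M (({s, t} : Set B) ∪ perpIdx M {s, t}) A)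
    -- the two simple markings, with supports containing `t` and `K ⊆ A`
    (ω₁ ω₂ : List B) (m₁ m₂ : B)
    (hμ₁ : IsSimpleMarking cs s ω₁ m₁) (hμ₂ : IsSimpleMarking cs s ω₂ m₂)
    (ht₁ : t ∈ ω₁) (ht₂ : t ∈ ω₂)
    (hK₁ : Kst M s t ω₁ m₁ ⊆ A) (hK₂ : Kst M s t ω₂ m₂ ⊆ A) :
    (IncidentWall cs' ((cs.wordProd ω₁) * cs.simple m₁ * (cs.wordProd ω₁)⁻¹) ⊆
        Hplus cs' (cs.simple s)) ↔
      (IncidentWall cs' ((cs.wordProd ω₂) * cs.simple m₂ * (cs.wordProd ω₂)⁻¹) ⊆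
        Hplus cs' (cs.simple s)) := by
  have hang : AngleC cs cs' := by
    intro a b hab hM
    obtain ⟨w, i, j, h⟩ := hangle a b hab hM
    have h1 : w * cs.simple a * w⁻¹ ∈ ({cs'.simple i, cs'.simple j} : Set W) := by
      rw [← h]; simp
    have h2 : w * cs.simple b * w⁻¹ ∈ ({cs'.simple i, cs'.simple j} : Set W) := by
      rw [← h]; simp
    rcases h1 with h1 | h1 <;> rcases h2 with h2 | h2
    · exact ⟨w, _, _, h1, h2⟩
    · exact ⟨w, _, _, h1, h2⟩
    · exact ⟨w, _, _, h1, h2⟩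
    · exact ⟨w, _, _, h1, h2⟩
  have hx : cs'.IsReflection (cs.simple s) := by
    obtain ⟨w, i, _, hi, _⟩ := hang s t hst hadj
    exact ⟨w⁻¹, i, by rw [← hi]; group⟩
  have hΦ := phiProp cs cs' hFC hang s hx
  have hsupp : supp s [t] = {s, t} := by
    unfold supp; ext x; simp
  have hg : Good M s [t] := by
    have := (good_snoc_iff M s [] t).2 ⟨Good.nil, ?_, s, core_mem_supp _ _, hncomm⟩
    · simpa using this
    · rintro (h | h)
      · exact hst h.symm
      · simp at h
  have hc : Clq M (supp s [t]) := by
    rw [hsupp]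
    rintro a (rfl | rfl) b (rfl | rfl) hab
    · exact absurd rfl hab
    · exact hadj
    · rw [M.symmetric]; exact hadj
    · exact absurd rfl hab
  have hH := extH_of_long cs hFC hrig s hΦ [t] hg hc (by simp)
  have hμ₁' := mark_of_simple cs hFC s ω₁ m₁ hμ₁
  have hμ₂' := mark_of_simple cs hFC s ω₂ m₂ hμ₂
  have hsub : ∀ ω : List B, t ∈ ω → supp s [t] ⊆ supp s ω := by
    intro ω hω
    rw [hsupp]
    rintro x (rfl | rfl)
    · exact core_mem_supp _ _
    · exact Or.inr hω
  obtain ⟨a, ha, hn, α, p, h1, h2, h3⟩ := node_exists hΦ hg hμ₁' (hsub ω₁ ht₁)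
  obtain ⟨a', ha', hn', α', p', h1', h2', h3'⟩ := node_exists hΦ hg hμ₂' (hsub ω₂ ht₂)
  have haA := node_in_comp hsupp hK₁ ha hn
  have haA' := node_in_comp hsupp hK₂ ha' hn'
  obtain ⟨a₀, ha₀, rfl⟩ := hA
  rw [← hsupp] at haA haA'
  have hp : Relation.ReflTransGen (fun x y => x ∉ supp s [t] ∪ perpIdx M (supp s [t]) ∧
      y ∉ supp s [t] ∪ perpIdx M (supp s [t]) ∧ x ≠ y ∧ M x y ≠ 0) a a' := by
    refine Relation.ReflTransGen.trans ?_ haA'.2.2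
    exact path_symm haA.2.2
  exact h3.trans ((path_conclude hΦ hg hc hH ha' hp h1 h2 h1' h2').trans h3'.symm)
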